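/- arXiv:1007.4096 — 11 statements merged into one kernel-verified Lean document; each statement's English description precedes it below -/
import Mathlib

section
/- For all positive integers n and k, there exists a simple k-latin square of order n if and only if n ≥ k. -/
/-- A `k`-latin square of order `n`: an `n × n` array of multisets of symbols from
`Fin n`, each cell of cardinality `k`, such that each symbol occurs exactly `k` times
in each row and exactly `k` times in each column (counting multiplicity). -/
def IsMultiLatin (n k : ℕ) (L : Fin n → Fin n → Multiset (Fin n)) : Prop :=
  (∀ i j, (L i j).card = k) ∧
  (∀ i s, (∑ j, (L i j).count s) = k) ∧
  (∀ j s, (∑ i, (L i j).count s) = k)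

/-- A partial `k`-latin square of order `n`: each cell has cardinality at most `k`,
and each symbol occurs at most `k` times in each row and in each column. -/
def IsPartialMultiLatin (n k : ℕ) (P : Fin n → Fin n → Multiset (Fin n)) : Prop :=
  (∀ i j, (P i j).card ≤ k) ∧
  (∀ i s, (∑ j, (P i j).count s) ≤ k) ∧
  (∀ j s, (∑ i, (P i j).count s) ≤ k)

/-- An `m × n` `k`-latin rectangle: a partial `k`-latin square of order `n` in which
every cell of the first `m` rows contains exactly `k` symbols and the remaining rows
are empty. -/
def IsLatinRectangle (m n k : ℕ) (P : Fin n → Fin n → Multiset (Fin n)) : Prop :=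
  IsPartialMultiLatin n k P ∧
  (∀ (i j : Fin n), (i : ℕ) < m → (P i j).card = k) ∧
  (∀ (i j : Fin n), m ≤ (i : ℕ) → P i j = 0)

/-- A `k`-latin square is separable if it is the join (cellwise multiset union) of a
`k₁`-latin square and a `k₂`-latin square with `k₁, k₂` positive and `k₁ + k₂ = k`. -/
def Separable (n k : ℕ) (L : Fin n → Fin n → Multiset (Fin n)) : Prop :=
  ∃ k1 k2 : ℕ, 0 < k1 ∧ 0 < k2 ∧ k1 + k2 = k ∧
    ∃ L1 L2 : Fin n → Fin n → Multiset (Fin n),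
      IsMultiLatin n k1 L1 ∧ IsMultiLatin n k2 L2 ∧ ∀ i j, L i j = L1 i j + L2 i j

/-- A `k`-latin square is erodable if it is the join of a `(k-1)`-latin square and a
latin square (a `1`-latin square). -/
def Erodable (n k : ℕ) (L : Fin n → Fin n → Multiset (Fin n)) : Prop :=
  ∃ L1 L2 : Fin n → Fin n → Multiset (Fin n),
    IsMultiLatin n (k - 1) L1 ∧ IsMultiLatin n 1 L2 ∧ ∀ i j, L i j = L1 i j + L2 i j

/-- A `k`-latin square is fully separable if it is the join of `k` latin squares. -/
def FullySeparable (n k : ℕ) (L : Fin n → Fin n → Multiset (Fin n)) : Prop :=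
  ∃ M : Fin k → Fin n → Fin n → Multiset (Fin n),
    (∀ t, IsMultiLatin n 1 (M t)) ∧ ∀ i j, L i j = ∑ t, M t i j

/-- The cyclic array on `Fin n` whose cell `(i, j)` is the translate of `T` by `i + j`. -/
def cyclicArray {n : ℕ} [NeZero n] (T : Finset (Fin n)) (i j : Fin n) : Multiset (Fin n) :=
  (T.map (Equiv.addRight (i + j)).toEmbedding).val

theorem cyclicArray_nodup {n : ℕ} [NeZero n] (T : Finset (Fin n)) (i j : Fin n) :
    (cyclicArray T i j).Nodup :=
  Finset.nodup _

theorem cyclicArray_comm {n : ℕ} [NeZero n] (T : Finset (Fin n)) (i j : Fin n) :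
    cyclicArray T i j = cyclicArray T j i := by
  rw [cyclicArray, add_comm i j, cyclicArray]

theorem count_cyclicArray {n : ℕ} [NeZero n] (T : Finset (Fin n)) (i j s : Fin n) :
    (cyclicArray T i j).count s = if s - i - j ∈ T then 1 else 0 := by
  rw [Multiset.count_eq_of_nodup (cyclicArray_nodup T i j)]
  rw [sub_sub, sub_eq_add_neg]
  simp only [cyclicArray, Finset.mem_val, Finset.mem_map_equiv, Equiv.addRight_symm,
    Equiv.coe_addRight]

theorem sum_count_cyclicArray {n : ℕ} [NeZero n] (T : Finset (Fin n)) (i s : Fin n) :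
    ∑ j, (cyclicArray T i j).count s = T.card := by
  simp_rw [count_cyclicArray]
  refine ((Equiv.subLeft (s - i)).sum_comp (fun x => if x ∈ T then 1 else 0)).trans ?_
  simp

theorem isMultiLatin_cyclicArray {n : ℕ} [NeZero n] (T : Finset (Fin n)) :
    IsMultiLatin n T.card (cyclicArray T) := by
  refine ⟨fun i j => Finset.card_map _, sum_count_cyclicArray T, fun j s => ?_⟩
  simp_rw [cyclicArray_comm T _ j]
  exact sum_count_cyclicArray T j s

/-- For all positive integers `n` and `k`, there exists a simple `k`-latin square of
order `n` (one in which no cell has a repeated symbol) if and only if `n ≥ k`. -/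
theorem stmt_1 (n k : ℕ) (hn : 0 < n) (hk : 0 < k) :
    (∃ L : Fin n → Fin n → Multiset (Fin n),
        IsMultiLatin n k L ∧ ∀ i j, (L i j).Nodup) ↔ k ≤ n := by
  have : NeZero n := ⟨hn.ne'⟩
  constructor
  · rintro ⟨L, ⟨hcard, -, -⟩, hnodup⟩
    have h := Finset.card_le_univ ⟨L 0 0, hnodup 0 0⟩
    rwa [Finset.card_mk, hcard, Fintype.card_fin] at h
  · intro hkn
    obtain ⟨T, -, rfl⟩ := Finset.exists_subset_card_eq
      (s := (Finset.univ : Finset (Fin n))) (n := k) (by simpa using hkn)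
    exact ⟨cyclicArray T, isMultiLatin_cyclicArray T, cyclicArray_nodup T⟩
end

section
/- For all positive integers k and all integers 1 ≤ m ≤ n, every m×n k-latin rectangle embeds in (i.e., can be completed to) a k-latin square of order n. -/
/-- A nonnegative integer matrix with all row and column sums equal to `d + 1` has a
transversal of positive entries. -/
theorem exists_perm_pos_of_sums_eq {α : Type*} [Fintype α] [DecidableEq α] {d : ℕ}
    {D : α → α → ℕ} (hrow : ∀ i, ∑ j, D i j = d + 1) (hcol : ∀ j, ∑ i, D i j = d + 1) :
    ∃ σ : Equiv.Perm α, ∀ i, 0 < D i (σ i) := by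
  have hall := (Finset.all_card_le_biUnion_card_iff_exists_injective
    (fun i => Finset.univ.filter (fun j => 0 < D i j))).1 (by
      intro S
      set N := S.biUnion (fun i => Finset.univ.filter (fun j => 0 < D i j)) with hN
      have h1 : ∑ i ∈ S, ∑ j, D i j = ∑ i ∈ S, ∑ j ∈ N, D i j := by
        refine Finset.sum_congr rfl fun i hi => ?_
        refine (Finset.sum_subset (Finset.subset_univ N) fun j _ hj => ?_).symm
        by_contra h
        exact hj (Finset.mem_biUnion.2 ⟨i, hi, by simpa using Nat.pos_of_ne_zero h⟩)
      have h2 : ∑ i ∈ S, ∑ j ∈ N, D i j ≤ ∑ j ∈ N, ∑ i, D i j := by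
        rw [Finset.sum_comm]
        exact Finset.sum_le_sum fun j _ =>
          Finset.sum_le_sum_of_subset (Finset.subset_univ S)
      rw [← h1] at h2
      simp only [hrow, hcol, Finset.sum_const, smul_eq_mul] at h2
      exact Nat.le_of_mul_le_mul_right h2 (Nat.succ_pos d))
  obtain ⟨f, hf, hpos⟩ := hall
  refine ⟨Equiv.ofBijective f (Finite.injective_iff_bijective.1 hf), fun i => ?_⟩
  simpa using hpos i

/-- A nonnegative integer matrix with all line sums equal to `d + k` is the sum of one with
line sums `d` and one with line sums `k`. -/
theorem exists_add_eq_of_sums_eq_add {α : Type*} [Fintype α] [DecidableEq α] (k d : ℕ)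
    (D : α → α → ℕ) (hrow : ∀ i, ∑ j, D i j = d + k) (hcol : ∀ j, ∑ i, D i j = d + k) :
    ∃ A B : α → α → ℕ, (∀ i, ∑ j, A i j = d) ∧ (∀ j, ∑ i, A i j = d) ∧
      (∀ i, ∑ j, B i j = k) ∧ (∀ j, ∑ i, B i j = k) ∧ ∀ i j, D i j = A i j + B i j := by
  induction k generalizing D with
  | zero => exact ⟨D, fun _ _ => 0, hrow, hcol, by simp, by simp, by simp⟩
  | succ k ih =>
    obtain ⟨σ, hσ⟩ := exists_perm_pos_of_sums_eq (d := d + k) hrow hcol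
    let Q : α → α → ℕ := fun i j => if σ i = j then 1 else 0
    have hQr : ∀ i, ∑ j, Q i j = 1 := fun i => by simp [Q]
    have hQc : ∀ j, ∑ i, Q i j = 1 := fun j => by simp [Q, ← Equiv.eq_symm_apply]
    have hD : ∀ i j, (D i j - Q i j) + Q i j = D i j := fun i j => by
      refine Nat.sub_add_cancel ?_
      simp only [Q]
      split_ifs with h
      · exact h ▸ hσ i
      · exact Nat.zero_le _
    obtain ⟨A, B, h1, h2, h3, h4, h5⟩ := ih (fun i j => D i j - Q i j)
      (fun i => by
        have h := hrow i
        rw [← Finset.sum_congr rfl fun j _ => hD i j, Finset.sum_add_distrib, hQr] at h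
        omega)
      (fun j => by
        have h := hcol j
        rw [← Finset.sum_congr rfl fun i _ => hD i j, Finset.sum_add_distrib, hQc] at h
        omega)
    refine ⟨A, fun i j => B i j + Q i j, h1, h2, ?_, ?_, ?_⟩
    · simp [Finset.sum_add_distrib, h3, hQr]
    · simp [Finset.sum_add_distrib, h4, hQc]
    · intro i j
      rw [← hD i j, h5 i j, add_assoc]

/-- A nonnegative integer matrix with all line sums equal to `r * k` is a sum of `r` such
matrices with line sums `k`. -/
theorem exists_sum_eq_of_sums_eq_mul {α : Type*} [Fintype α] [DecidableEq α] (r k : ℕ)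
    (D : α → α → ℕ) (hrow : ∀ i, ∑ j, D i j = r * k) (hcol : ∀ j, ∑ i, D i j = r * k) :
    ∃ F : Fin r → α → α → ℕ, (∀ t i, ∑ j, F t i j = k) ∧ (∀ t j, ∑ i, F t i j = k) ∧
      ∀ i j, ∑ t, F t i j = D i j := by
  induction r generalizing D with
  | zero =>
    refine ⟨fun t => t.elim0, fun t => t.elim0, fun t => t.elim0, fun i j => ?_⟩
    have h := hrow i
    rw [Nat.zero_mul, Finset.sum_eq_zero_iff] at h
    simp [h j (Finset.mem_univ j)]
  | succ r ih =>
    obtain ⟨A, B, h1, h2, h3, h4, h5⟩ := exists_add_eq_of_sums_eq_add k (r * k) D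
      (fun i => by rw [hrow, Nat.succ_mul]) (fun j => by rw [hcol, Nat.succ_mul])
    obtain ⟨F, f1, f2, f3⟩ := ih A h1 h2
    refine ⟨Fin.cons B F, ?_, ?_, ?_⟩
    · intro t
      refine Fin.cases ?_ (fun t => ?_) t
      · simpa using h3
      · simpa using f1 t
    · intro t
      refine Fin.cases ?_ (fun t => ?_) t
      · simpa using h4
      · simpa using f2 t
    · intro i j
      simp [Fin.sum_univ_succ, f3, h5, add_comm]

theorem Multiset.sum_count_univ {α : Type*} [Fintype α] [DecidableEq α] (M : Multiset α) :
    ∑ s, M.count s = M.card :=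
  Multiset.sum_count_eq_card fun _ _ => Finset.mem_univ _

theorem Multiset.count_sum_nsmul_singleton {α : Type*} [Fintype α] [DecidableEq α]
    (f : α → ℕ) (s : α) : (∑ a, f a • ({a} : Multiset α)).count s = f s := by
  simp [Multiset.count_sum', Multiset.count_singleton]

/-- Every `m × n` `k`-latin rectangle (`1 ≤ m ≤ n`, `k` positive) can be completed to a
`k`-latin square of order `n`. -/
theorem stmt_2 (k m n : ℕ) (hk : 0 < k) (hm : 1 ≤ m) (hmn : m ≤ n)
    (P : Fin n → Fin n → Multiset (Fin n)) (hP : IsLatinRectangle m n k P) :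
    ∃ L : Fin n → Fin n → Multiset (Fin n), IsMultiLatin n k L ∧ ∀ i j, P i j ≤ L i j := by
  obtain ⟨r, rfl⟩ := Nat.exists_eq_add_of_le hmn
  obtain ⟨⟨-, hrow, hcol⟩, hfull, hempty⟩ := hP
  have hcard : ∀ (i : Fin m) j, (P (Fin.castAdd r i) j).card = k := fun i j =>
    hfull _ j i.isLt
  have hrow_eq : ∀ (i : Fin m) s, ∑ j, (P (Fin.castAdd r i) j).count s = k := by
    intro i s
    refine (Finset.sum_eq_sum_iff_of_le (s := Finset.univ)
      (f := fun s => ∑ j, (P (Fin.castAdd r i) j).count s) (g := fun _ => k)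
      fun s _ => hrow _ s).1 ?_ s (Finset.mem_univ s)
    rw [Finset.sum_comm]
    simp only [Multiset.sum_count_univ, hcard]
  let C : Fin (m + r) → Fin (m + r) → ℕ := fun j s =>
    ∑ i : Fin m, (P (Fin.castAdd r i) j).count s
  have hC : ∀ j s, (k - C j s) + C j s = k := by
    intro j s
    refine Nat.sub_add_cancel ?_
    have h := hcol j s
    rw [Fin.sum_univ_add] at h
    exact (Nat.le_add_right _ _).trans h
  have hCs : ∀ j, ∑ s, C j s = m * k := by
    intro j
    simp only [C]
    rw [Finset.sum_comm]
    simp [hcard]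
  have hCj : ∀ s, ∑ j, C j s = m * k := by
    intro s
    simp only [C]
    rw [Finset.sum_comm]
    simp [hrow_eq]
  obtain ⟨F, hF1, hF2, hF3⟩ := exists_sum_eq_of_sums_eq_mul r k (fun j s => k - C j s)
    (fun j => by
      have h : ∑ s, ((k - C j s) + C j s) = (m + r) * k := by simp [hC]
      rw [Finset.sum_add_distrib, hCs] at h
      linarith)
    (fun s => by
      have h : ∑ j, ((k - C j s) + C j s) = (m + r) * k := by simp [hC]
      rw [Finset.sum_add_distrib, hCj] at h
      linarith)
  refine ⟨Fin.addCases (fun i => P (Fin.castAdd r i))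
    (fun t j => ∑ s, F t j s • ({s} : Multiset (Fin (m + r)))), ⟨?_, ?_, ?_⟩, ?_⟩
  · intro i j
    refine Fin.addCases (fun i => ?_) (fun t => ?_) i
    · simpa using hcard i j
    · simpa using hF1 t j
  · intro i s
    refine Fin.addCases (fun i => ?_) (fun t => ?_) i
    · simpa using hrow_eq i s
    · simpa only [Fin.addCases_right, Multiset.count_sum_nsmul_singleton] using hF2 t s
  · intro j s
    rw [Fin.sum_univ_add]
    simp only [Fin.addCases_left, Fin.addCases_right, Multiset.count_sum_nsmul_singleton, hF3]
    rw [add_comm]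
    exact hC j s
  · intro i j
    refine Fin.addCases (fun i => ?_) (fun t => ?_) i
    · simp
    · rw [hempty _ j (by simp)]
      exact Multiset.zero_le _
end

section
/- For all positive integers k, m and every integer n ≥ 2m, every partial k-latin square of order m embeds in a k-latin square of order n. -/
open Finset in
/-- A square matrix of natural numbers with all line sums `d + 1` dominates a permutation
matrix. -/
theorem exists_perm_pos_of_regular {α : Type*} [Fintype α] [DecidableEq α] (d : ℕ)
    (f : α → α → ℕ) (hr : ∀ a, ∑ b, f a b = d + 1) (hc : ∀ b, ∑ a, f a b = d + 1) :
    ∃ σ : Equiv.Perm α, ∀ a, 0 < f a (σ a) := by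
  obtain ⟨σ, hσ, h⟩ := (all_card_le_biUnion_card_iff_exists_injective
    (fun a => univ.filter fun b => 0 < f a b)).mp (by
      intro S
      set T := S.biUnion fun a => univ.filter fun b => 0 < f a b with hT
      have hS : ∑ a ∈ S, ∑ b ∈ T, f a b = #S * (d + 1) := by
        rw [← smul_eq_mul, ← sum_const]
        refine sum_congr rfl fun a ha => ?_
        rw [← hr a]
        refine sum_subset (subset_univ T) fun b _ hb => ?_
        by_contra hne
        exact hb (mem_biUnion.mpr ⟨a, ha, by simpa using Nat.pos_of_ne_zero hne⟩)
      have hle : ∑ a ∈ S, ∑ b ∈ T, f a b ≤ #T * (d + 1) := by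
        rw [sum_comm, ← smul_eq_mul, ← sum_const]
        refine sum_le_sum fun b _ => ?_
        rw [← hc b]
        exact sum_le_sum_of_subset (subset_univ S)
      exact Nat.le_of_mul_le_mul_right (hS ▸ hle) d.succ_pos)
  exact ⟨Equiv.ofBijective σ (Finite.injective_iff_bijective.mp hσ), fun a => by
    simpa using h a⟩

/-- A square matrix of natural numbers with all line sums `d` is a sum of `d` permutation
matrices. -/
theorem exists_perms_of_regular {α : Type*} [Fintype α] [DecidableEq α] (d : ℕ)
    (f : α → α → ℕ) (hr : ∀ a, ∑ b, f a b = d) (hc : ∀ b, ∑ a, f a b = d) :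
    ∃ c : Fin d → Equiv.Perm α, ∀ a b, ∑ t, (if c t a = b then 1 else 0) = f a b := by
  induction d generalizing f with
  | zero =>
    refine ⟨Fin.elim0, fun a b => ?_⟩
    have := Finset.sum_eq_zero_iff.mp (hr a) b (Finset.mem_univ b)
    simp [this]
  | succ d ih =>
    obtain ⟨σ, hσ⟩ := exists_perm_pos_of_regular d f hr hc
    have hle : ∀ a b, (if σ a = b then 1 else 0) ≤ f a b := fun a b => by
      split_ifs with h
      · exact h ▸ hσ a
      · exact Nat.zero_le _
    obtain ⟨c, hc'⟩ := ih (fun a b => f a b - if σ a = b then 1 else 0)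
      (fun a => by
        rw [Finset.sum_tsub_distrib _ fun b _ => hle a b, hr]
        simp)
      (fun b => by
        rw [Finset.sum_tsub_distrib _ fun a _ => hle a b, hc]
        simp [← Equiv.eq_symm_apply])
    refine ⟨Fin.cons σ c, fun a b => ?_⟩
    rw [Fin.sum_univ_succ]
    simp only [Fin.cons_zero, Fin.cons_succ, hc']
    exact Nat.add_sub_of_le (hle a b)

/-- A matrix of natural numbers with all line sums at most `N * k` is a sum of `N` matrices
with all line sums at most `k`. -/
theorem exists_split_of_sum_le {α β : Type*} [Fintype α] [Fintype β] (N k : ℕ)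
    (f : α → β → ℕ) (hr : ∀ a, ∑ b, f a b ≤ N * k) (hc : ∀ b, ∑ a, f a b ≤ N * k) :
    ∃ g : Fin N → α → β → ℕ, (∀ a b, ∑ t, g t a b = f a b) ∧
      (∀ t a, ∑ b, g t a b ≤ k) ∧ ∀ t b, ∑ a, g t a b ≤ k := by
  classical
  let F : α ⊕ β → β ⊕ α → ℕ := fun x y => match x, y with
    | .inl a, .inl b => f a b
    | .inl a, .inr a' => if a = a' then N * k - ∑ b, f a b else 0
    | .inr b, .inl b' => if b = b' then N * k - ∑ a, f a b else 0
    | .inr b, .inr a => f a b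
  obtain ⟨c, hF⟩ := exists_perms_of_regular (N * k)
    (fun x y => F x (Equiv.sumComm α β y))
    (fun x => by
      rw [Equiv.sum_comp (Equiv.sumComm α β) (F x)]
      rcases x with a | b
      · simpa [F] using Nat.add_sub_of_le (hr a)
      · simpa [F] using Nat.sub_add_cancel (hc b))
    (fun y => by
      rcases y with a | b
      · simpa [F] using Nat.sub_add_cancel (hr a)
      · simpa [F] using Nat.add_sub_of_le (hc b))
  refine ⟨fun t a b => ∑ u : Fin k,
    if c (finProdFinEquiv (t, u)) (.inl a) = .inr b then 1 else 0, fun a b => ?_,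
    fun t a => ?_, fun t b => ?_⟩
  · rw [← Fintype.sum_prod_type', Equiv.sum_comp finProdFinEquiv
      (fun t => if c t (Sum.inl a) = Sum.inr b then 1 else 0), hF]
    rfl
  · rw [Finset.sum_comm]
    refine (Finset.sum_le_card_nsmul _ _ 1 fun u _ => ?_).trans_eq (by simp)
    rw [Finset.sum_boole, Nat.cast_id, Finset.card_le_one]
    simp only [Finset.mem_filter, Finset.mem_univ, true_and]
    intro b hb b' hb'
    exact Sum.inr_injective (hb.symm.trans hb')
  · rw [Finset.sum_comm]
    refine (Finset.sum_le_card_nsmul _ _ 1 fun u _ => ?_).trans_eq (by simp)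
    rw [Finset.sum_boole, Nat.cast_id, Finset.card_le_one]
    simp only [Finset.mem_filter, Finset.mem_univ, true_and]
    intro a ha a' ha'
    exact Sum.inl_injective ((c _).injective (ha.trans ha'.symm))

/-- Adding `r` layers to a three-dimensional array so that its line sums in the direction
perpendicular to the layers become `k`. -/
theorem exists_layers {α β γ : Type*} [Fintype α] [Fintype β] [Fintype γ] (r k : ℕ)
    (R : α → β → γ → ℕ) (hγ : Fintype.card γ = Fintype.card α + r)
    (hab : ∀ a b, ∑ c, R a b c = k) (hbc : ∀ b c, ∑ a, R a b c ≤ k)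
    (hc : ∀ c, Fintype.card β * k ≤ r * k + ∑ b, ∑ a, R a b c) :
    ∃ g : Fin r → β → γ → ℕ, (∀ t b, ∑ c, g t b c = k) ∧ (∀ t c, ∑ b, g t b c ≤ k) ∧
      ∀ b c, ∑ a, R a b c + ∑ t, g t b c = k := by
  have hrow : ∀ b, ∑ c, (k - ∑ a, R a b c) = r * k := fun b => by
    rw [Finset.sum_tsub_distrib _ fun c _ => hbc b c, Finset.sum_comm]
    simp [hab, hγ, add_mul]
  obtain ⟨g, hg, hgr, hgc⟩ := exists_split_of_sum_le r k (fun b c => k - ∑ a, R a b c)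
    (fun b => (hrow b).le)
    (fun c => by
      rw [Finset.sum_tsub_distrib _ fun b _ => hbc b c]
      simpa using hc c)
  refine ⟨g, fun t b => ?_, hgc, fun b c => by rw [hg]; exact Nat.add_sub_of_le (hbc b c)⟩
  have hsum : ∑ t, ∑ c, g t b c = ∑ _t : Fin r, k := by
    rw [Finset.sum_comm]
    simp [hg, hrow]
  exact (Finset.sum_eq_sum_iff_of_le fun t _ => hgr t b).mp hsum t (Finset.mem_univ t)

/-- An `m × m × m` array with line sums at most `k` extends to an array of order `m + r`,
`m ≤ r`, with all line sums `k`. -/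
theorem exists_extend_array (k m r : ℕ) [NeZero m] (hr : m ≤ r)
    (p : Fin m → Fin m → Fin m → ℕ) (h₁ : ∀ i j, ∑ s, p i j s ≤ k)
    (h₂ : ∀ i s, ∑ j, p i j s ≤ k) (h₃ : ∀ j s, ∑ i, p i j s ≤ k) :
    ∃ F : Fin m ⊕ Fin r → Fin m ⊕ Fin r → Fin m ⊕ Fin r → ℕ,
      (∀ i j, ∑ s, F i j s = k) ∧ (∀ i s, ∑ j, F i j s = k) ∧ (∀ j s, ∑ i, F i j s = k) ∧
      ∀ i j s, F (.inl i) (.inl j) (.inl s) = p i j s := by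
  let Q : Fin m → Fin m → Fin m ⊕ Fin r → ℕ := fun i j => Sum.elim (p i j)
    fun t => if Fin.castLE hr (i + j) = t then k - ∑ s, p i j s else 0
  have hQ₁ : ∀ i j, ∑ s, Q i j s = k := fun i j => by
    simpa [Q] using Nat.add_sub_of_le (h₁ i j)
  have aux : ∀ (q : Fin m → ℕ) (e : Fin m → Fin r), Function.Injective e →
      (∀ i, q i ≤ k) → ∀ t, ∑ i, (if e i = t then q i else 0) ≤ k := by
    intro q e he hq t
    by_cases h : ∃ i, e i = t
    · obtain ⟨i, rfl⟩ := h
      simpa [he.eq_iff] using hq i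
    · push Not at h
      simp [h]
  have hQ₂ : ∀ i s, ∑ j, Q i j s ≤ k := by
    rintro i (s | t)
    · exact h₂ i s
    · exact aux _ (fun j => Fin.castLE hr (i + j))
        ((Fin.castLE_injective hr).comp (add_right_injective i)) (fun _ => Nat.sub_le _ _) t
  have hQ₃ : ∀ j s, ∑ i, Q i j s ≤ k := by
    rintro j (s | t)
    · exact h₃ j s
    · exact aux _ (fun i => Fin.castLE hr (i + j))
        ((Fin.castLE_injective hr).comp (add_left_injective j)) (fun _ => Nat.sub_le _ _) t
  obtain ⟨g, hg₁, hg₂, hg₃⟩ := exists_layers r k (fun j i s => Q i j s) (by simp)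
    (fun j i => hQ₁ i j) hQ₂
    (fun s => by simpa using (Nat.mul_le_mul_right k hr).trans (Nat.le_add_right _ _))
  let R : Fin m → Fin m ⊕ Fin r → Fin m ⊕ Fin r → ℕ := fun i =>
    Sum.elim (Q i) fun t => g t i
  have hR₁ : ∀ i j, ∑ s, R i j s = k := by
    rintro i (j | t)
    · exact hQ₁ i j
    · exact hg₁ t i
  have hR₂ : ∀ i s, ∑ j, R i j s = k := fun i s => by simpa [R] using hg₃ i s
  have hR₃ : ∀ j s, ∑ i, R i j s ≤ k := by
    rintro (j | t) s
    · exact hQ₃ j s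
    · exact hg₂ t s
  obtain ⟨h, hh₁, hh₂, hh₃⟩ := exists_layers r k R (by simp) hR₁ hR₃
    (fun s => by
      rw [Finset.sum_comm]
      simp [hR₂, add_mul, add_comm])
  have hh₂' : ∀ t s, ∑ j, h t j s = k := by
    intro t s
    have hsum : ∑ t, ∑ j, h t j s = ∑ _t : Fin r, k := by
      have hall : ∑ j, (∑ i, R i j s + ∑ t, h t j s) = (m + r) * k := by simp [hh₃]
      have hR : ∑ j, ∑ i, R i j s = m * k := by
        rw [Finset.sum_comm]
        simp [hR₂]
      rw [Finset.sum_add_distrib, hR, Finset.sum_comm (f := fun j t => h t j s), add_mul] at hall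
      simpa using hall
    exact (Finset.sum_eq_sum_iff_of_le fun t _ => hh₂ t s).mp hsum t (Finset.mem_univ t)
  refine ⟨Sum.elim R h, ?_, ?_, fun j s => by simpa using hh₃ j s, fun i j s => rfl⟩
  · rintro (i | t) j
    · exact hR₁ i j
    · exact hh₁ t j
  · rintro (i | t) s
    · exact hR₂ i s
    · exact hh₂' t s

/-- For all positive integers `k, m` and every `n ≥ 2m`, every partial `k`-latin square
of order `m` embeds in a `k`-latin square of order `n` (placing it in the top-left
`m × m` subarray and identifying its symbols with the first `m` symbols). -/
theorem stmt_3 (k m n : ℕ) (hk : 0 < k) (hm : 0 < m) (hn : 2 * m ≤ n)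
    (P : Fin m → Fin m → Multiset (Fin m)) (hP : IsPartialMultiLatin m k P) :
    ∃ L : Fin n → Fin n → Multiset (Fin n), IsMultiLatin n k L ∧
      ∀ i j : Fin m,
        (P i j).map (Fin.castLE (by omega)) ≤
          L (Fin.castLE (by omega) i) (Fin.castLE (by omega) j) := by
  obtain ⟨r, rfl⟩ : ∃ r, n = m + r := ⟨n - m, by omega⟩
  have : NeZero m := ⟨hm.ne'⟩
  obtain ⟨hcell, hrow, hcol⟩ := hP
  obtain ⟨F, hF₁, hF₂, hF₃, hFp⟩ := exists_extend_array k m r (by omega)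
    (fun i j s => (P i j).count s)
    (fun i j => by simpa [Multiset.sum_count_eq_card] using hcell i j) hrow hcol
  let e : Fin (m + r) ≃ Fin m ⊕ Fin r := finSumFinEquiv.symm
  let L : Fin (m + r) → Fin (m + r) → Multiset (Fin (m + r)) := fun i j =>
    ∑ s, F (e i) (e j) (e s) • {s}
  have hL : ∀ i j s, (L i j).count s = F (e i) (e j) (e s) := fun i j s => by
    simp [L, Multiset.count_sum', Multiset.count_singleton]
  refine ⟨L, ⟨fun i j => ?_, fun i s => ?_, fun j s => ?_⟩, fun i j => ?_⟩
  · rw [← hF₁ (e i) (e j), ← Equiv.sum_comp e]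
    simp [L]
  · simp only [hL]
    rw [Equiv.sum_comp e fun j => F (e i) j (e s), hF₂]
  · simp only [hL]
    rw [Equiv.sum_comp e fun i => F i (e j) (e s), hF₃]
  · have he : ∀ (h : m ≤ m + r) (i : Fin m), e (Fin.castLE h i) = .inl i := fun h i =>
      finSumFinEquiv_symm_apply_castAdd i
    rw [Multiset.le_iff_count]
    intro s
    rw [hL, he, he]
    by_cases hs : ∃ s', Fin.castLE (Nat.le_add_right m r) s' = s
    · obtain ⟨s, rfl⟩ := hs
      rw [Multiset.count_map_eq_count' _ _ (Fin.castLE_injective _), he, hFp]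
    · rw [Multiset.count_eq_zero_of_notMem]
      · exact Nat.zero_le _
      · intro hmem
        obtain ⟨s', -, hs'⟩ := Multiset.mem_map.mp hmem
        exact hs ⟨s', hs'⟩
end

section
/- For all positive integers k and m, no k-latin square of order m embeds in a k-latin square of order n with m < n < 2m; that is, the bound n ≥ 2m in the embedding theorem for k-latin squares is best possible. -/
/-- If a `k`-latin square of order `m` sits in the top-left corner of a `k`-latin square of
order `m + d`, the first `m` symbols do not occur in the top-right block. -/
theorem IsMultiLatin.count_castAdd_natAdd_eq_zero {k m d : ℕ}
    {P : Fin m → Fin m → Multiset (Fin m)} (hP : IsMultiLatin m k P)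
    {L : Fin (m + d) → Fin (m + d) → Multiset (Fin (m + d))} (hL : IsMultiLatin (m + d) k L)
    (h : ∀ i j : Fin m, (P i j).map (Fin.castAdd d) ≤ L (Fin.castAdd d i) (Fin.castAdd d j))
    (i s : Fin m) (j : Fin d) :
    (L (Fin.castAdd d i) (Fin.natAdd m j)).count (Fin.castAdd d s) = 0 := by
  have hrow := hL.2.1 (Fin.castAdd d i) (Fin.castAdd d s)
  rw [Fin.sum_univ_add] at hrow
  have hle : ∑ j, (P i j).count s ≤
      ∑ j, (L (Fin.castAdd d i) (Fin.castAdd d j)).count (Fin.castAdd d s) := by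
    refine Finset.sum_le_sum fun j _ => ?_
    rw [← Multiset.count_map_eq_count' _ _ (Fin.castAdd_injective m d) s]
    exact Multiset.count_le_of_le _ (h i j)
  rw [hP.2.1 i s] at hle
  have hzero : ∑ j, (L (Fin.castAdd d i) (Fin.natAdd m j)).count (Fin.castAdd d s) = 0 := by
    omega
  exact Finset.sum_eq_zero_iff.mp hzero j (Finset.mem_univ j)

/-- No `k`-latin square of order `m` embeds in a `k`-latin square of order `n` when
`m < n < 2m`: the bound `n ≥ 2m` in the embedding theorem is best possible. -/
theorem stmt_4 (k m n : ℕ) (hk : 0 < k) (hm : 0 < m) (h1 : m < n) (h2 : n < 2 * m)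
    (P : Fin m → Fin m → Multiset (Fin m)) (hP : IsMultiLatin m k P)
    (L : Fin n → Fin n → Multiset (Fin n)) (hL : IsMultiLatin n k L) :
    ¬ ∀ i j : Fin m,
        (P i j).map (Fin.castLE (by omega)) ≤
          L (Fin.castLE (by omega) i) (Fin.castLE (by omega) j) := by
  obtain ⟨d, rfl⟩ := Nat.exists_eq_add_of_le h1.le
  intro h
  obtain ⟨c, hzero⟩ : ∃ c, ∀ i s : Fin m,
      (L (Fin.castAdd d i) c).count (Fin.castAdd d s) = 0 :=
    ⟨Fin.natAdd m ⟨0, by omega⟩,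
      fun i s => hP.count_castAdd_natAdd_eq_zero hL h i s ⟨0, by omega⟩⟩
  have hcard (i : Fin m) :
      ∑ s, (L (Fin.castAdd d i) c).count (Fin.natAdd m s) = k := by
    have hsum := Multiset.sum_count_eq_card (s := Finset.univ)
      (m := L (Fin.castAdd d i) c) fun a _ => Finset.mem_univ a
    rw [hL.1, Fin.sum_univ_add] at hsum
    simpa [hzero] using hsum
  have hcol (s : Fin d) :
      ∑ i, (L (Fin.castAdd d i) c).count (Fin.natAdd m s) ≤ k := by
    have hsum := hL.2.2 c (Fin.natAdd m s)
    rw [Fin.sum_univ_add] at hsum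
    omega
  have hle : m * k ≤ d * k :=
    calc m * k = ∑ i, ∑ s, (L (Fin.castAdd d i) c).count (Fin.natAdd m s) := by
          simp [hcard]
      _ = ∑ s, ∑ i, (L (Fin.castAdd d i) c).count (Fin.natAdd m s) :=
          Finset.sum_comm
      _ ≤ ∑ _s : Fin d, k := Finset.sum_le_sum fun s _ => hcol s
      _ = d * k := by simp
  have := Nat.le_of_mul_le_mul_right hle hk
  omega
end

section
/- There exists a 2×3 simple 2-latin rectangle of order 3 (for instance the rectangle whose two filled rows are both ({1,2},{1,3},{2,3})) that cannot be completed to a simple 2-latin square of order 3. -/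
/-- There exists a `2 × 3` simple `2`-latin rectangle of order `3` that cannot be
completed to a simple `2`-latin square of order `3`. -/
theorem stmt_5 :
    ∃ P : Fin 3 → Fin 3 → Multiset (Fin 3),
      IsLatinRectangle 2 3 2 P ∧ (∀ i j, (P i j).Nodup) ∧
      ¬ ∃ L : Fin 3 → Fin 3 → Multiset (Fin 3),
          IsMultiLatin 3 2 L ∧ (∀ i j, (L i j).Nodup) ∧
          ∀ (i j : Fin 3), (i : ℕ) < 2 → P i j = L i j := by
  refine ⟨![![{0, 1}, {0, 2}, {1, 2}], ![{0, 1}, {0, 2}, {1, 2}], ![0, 0, 0]],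
    ?_, by decide, ?_⟩
  · unfold IsLatinRectangle IsPartialMultiLatin
    decide
  · rintro ⟨L, ⟨-, -, hcol⟩, hnodup, hext⟩
    have hsum := hcol 0 2
    have hle := Multiset.nodup_iff_count_le_one.mp (hnodup 2 0) 2
    rw [Fin.sum_univ_three, ← hext 0 0 (by decide), ← hext 1 0 (by decide)] at hsum
    simp at hsum
    omega
end

section
/- There exists a non-separable 2-latin square of order n if and only if n ≥ 3. -/
open Equiv

/-- A square matrix of natural numbers with all row and column sums equal to `d > 0` has a
permutation contained in its support. -/
lemma exists_perm_forall_pos {α : Type*} [Fintype α] [DecidableEq α] {W : α → α → ℕ} {d : ℕ}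
    (hd : 0 < d) (hrow : ∀ i, ∑ j, W i j = d) (hcol : ∀ j, ∑ i, W i j = d) :
    ∃ σ : Perm α, ∀ i, 0 < W i (σ i) := by
  let f (i : α) : Finset α := {j | W i j ≠ 0}
  have hf (A : Finset α) : A.card ≤ (A.biUnion f).card := by
    have hsum (i : α) : ∑ j ∈ f i, W i j = d := by rw [← hrow i, Finset.sum_filter_ne_zero]
    refine le_of_mul_le_mul_right ?_ hd
    calc A.card * d = ∑ i ∈ A, ∑ j ∈ f i, W i j := by simp [hsum]
      _ ≤ ∑ i ∈ A, ∑ j ∈ A.biUnion f, W i j := Finset.sum_le_sum fun i hi =>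
          Finset.sum_le_sum_of_subset (Finset.subset_biUnion_of_mem f hi)
      _ ≤ ∑ i, ∑ j ∈ A.biUnion f, W i j := Finset.sum_le_sum_of_subset (Finset.subset_univ A)
      _ = (A.biUnion f).card * d := by rw [Finset.sum_comm]; simp [hcol]
  obtain ⟨g, hg, hgf⟩ := (Finset.all_card_le_biUnion_card_iff_exists_injective f).1 hf
  refine ⟨Equiv.ofBijective g (Finite.injective_iff_bijective.1 hg), fun i => ?_⟩
  simpa [f, Nat.pos_iff_ne_zero] using hgf i

/-- A square matrix of natural numbers with all row and column sums equal to `d` is a sum of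
`d` permutation matrices. -/
lemma exists_eq_sum_perm {α : Type*} [Fintype α] [DecidableEq α] (d : ℕ) (W : α → α → ℕ)
    (hrow : ∀ i, ∑ j, W i j = d) (hcol : ∀ j, ∑ i, W i j = d) :
    ∃ p : Fin d → Perm α, ∀ i j, (∑ t, if j = p t i then 1 else 0) = W i j := by
  induction d generalizing W with
  | zero =>
    refine ⟨Fin.elim0, fun i j => ?_⟩
    have := Finset.sum_eq_zero_iff.1 (hrow i) j (Finset.mem_univ j)
    simp [this]
  | succ d ih =>
    obtain ⟨σ, hσ⟩ := exists_perm_forall_pos d.succ_pos hrow hcol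
    have hW (i j : α) : W i j - (if j = σ i then 1 else 0) + (if j = σ i then 1 else 0) =
        W i j := by
      split_ifs with h
      · have := hσ i
        rw [← h] at this
        omega
      · simp
    obtain ⟨p, hp⟩ := ih (fun i j => W i j - if j = σ i then 1 else 0)
      (fun i => by
        have := hrow i
        rw [← Finset.sum_congr rfl fun j _ => hW i j, Finset.sum_add_distrib] at this
        simpa using this)
      (fun j => by
        have := hcol j
        rw [← Finset.sum_congr rfl fun i _ => hW i j, Finset.sum_add_distrib] at this
        simpa [← Equiv.symm_apply_eq] using this)
    refine ⟨Fin.cons σ p, fun i j => ?_⟩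
    simp only [Fin.sum_univ_succ, Fin.cons_zero, Fin.cons_succ]
    rw [hp, add_comm, hW]

lemma sum_count_singleton_perm {α : Type*} [Fintype α] [DecidableEq α] (σ : Perm α) (s : α) :
    ∑ j, Multiset.count s {σ j} = 1 := by
  simp [Multiset.count_singleton, ← Equiv.symm_apply_eq]

/-- Two rows that form a `2`-latin rectangle extend to a `2`-latin square. -/
lemma exists_isMultiLatin_extending_two_rows {m : ℕ} (R S : Fin (m + 2) → Multiset (Fin (m + 2)))
    (hRcard : ∀ j, (R j).card = 2) (hScard : ∀ j, (S j).card = 2)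
    (hR : ∀ s, ∑ j, (R j).count s = 2) (hS : ∀ s, ∑ j, (S j).count s = 2)
    (hcol : ∀ j s, (R j).count s + (S j).count s ≤ 2) :
    ∃ L, IsMultiLatin (m + 2) 2 L ∧ L 0 = R ∧ L 1 = S := by
  have hW (j s) : (2 - ((R j).count s + (S j).count s)) + ((R j).count s + (S j).count s) = 2 :=
    Nat.sub_add_cancel (hcol j s)
  obtain ⟨p, hp⟩ := exists_eq_sum_perm (m * 2)
    (fun j s => 2 - ((R j).count s + (S j).count s))
    (fun j => by
      have h := Finset.sum_congr rfl fun s (_ : s ∈ Finset.univ) => hW j s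
      simp only [Finset.sum_add_distrib, Finset.sum_const, Finset.card_univ, Fintype.card_fin,
        smul_eq_mul, Multiset.sum_count_eq_card (fun a _ => Finset.mem_univ a), hRcard,
        hScard] at h
      omega)
    (fun s => by
      have h := Finset.sum_congr rfl fun j (_ : j ∈ Finset.univ) => hW j s
      simp only [Finset.sum_add_distrib, Finset.sum_const, Finset.card_univ, Fintype.card_fin,
        smul_eq_mul, hR, hS] at h
      omega)
  let T (i : Fin m) (j : Fin (m + 2)) : Multiset (Fin (m + 2)) :=
    {p (finProdFinEquiv (i, 0)) j} + {p (finProdFinEquiv (i, 1)) j}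
  refine ⟨Fin.cons R (Fin.cons S T), ⟨fun i j => ?_, fun i s => ?_, fun j s => ?_⟩, rfl, rfl⟩
  · refine Fin.cases (by simp [hRcard]) (Fin.cases (by simp [hScard]) fun i => ?_) i
    simp [T]
  · refine Fin.cases (by simp [hR]) (Fin.cases (by simp [hS]) fun i => ?_) i
    simp only [Fin.cons_succ, T, Multiset.count_add, Finset.sum_add_distrib,
      sum_count_singleton_perm]
  · have hT : ∑ i, (T i j).count s = 2 - ((R j).count s + (S j).count s) := by
      rw [← hp, ← finProdFinEquiv.sum_comp, Fintype.sum_prod_type]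
      simp only [T, Multiset.count_add, Multiset.count_singleton, Fin.sum_univ_two]
    simp only [Fin.sum_univ_succ (n := m + 1), Fin.sum_univ_succ (n := m), Fin.cons_zero,
      Fin.cons_succ, hT]
    have := hcol j s
    omega

/-- A `1`-latin square is given by an array of symbols that is injective along rows and
columns. -/
lemma IsMultiLatin.exists_eq_singleton {n : ℕ} {L : Fin n → Fin n → Multiset (Fin n)}
    (hL : IsMultiLatin n 1 L) :
    ∃ f : Fin n → Fin n → Fin n, (∀ i j, L i j = {f i j}) ∧ (∀ i, (f i).Injective) ∧
      ∀ j, (fun i => f i j).Injective := by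
  obtain ⟨hcell, hrow, hcol⟩ := hL
  choose f hf using fun i j => Multiset.card_eq_one.1 (hcell i j)
  simp only [hf, Multiset.count_singleton] at hrow hcol
  have key (g : Fin n → Fin n) (hg : ∀ s, (∑ j, if s = g j then 1 else 0) = 1) :
      g.Injective := fun a b hab => by
    have h := hg (g b)
    rw [Finset.sum_boole, Nat.cast_id] at h
    exact Finset.card_le_one.1 h.le a (by simp [hab]) b (by simp)
  exact ⟨f, hf, fun i => key _ (hrow i), fun j => key _ (hcol j)⟩

/-- A pattern in two rows that prevents a `2`-latin square from being separable. -/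
lemma not_separable_of_pattern {n : ℕ} {L : Fin n → Fin n → Multiset (Fin n)}
    {r r' x y z a : Fin n} (hr : r ≠ r') (hxy : x ≠ y)
    (hrx : L r x = {x} + {y}) (hry : L r y = {y} + {z})
    (hrx' : L r' x = {x} + {a}) (hry' : L r' y = {a} + {y}) : ¬ Separable n 2 L := by
  rintro ⟨k₁, k₂, h₁, h₂, hk, L₁, L₂, hL₁, hL₂, hL⟩
  obtain rfl : k₁ = 1 := by omega
  obtain rfl : k₂ = 1 := by omega
  obtain ⟨f, hf, hfr, hfc⟩ := hL₁.exists_eq_singleton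
  obtain ⟨g, hg, hgr, hgc⟩ := hL₂.exists_eq_singleton
  have pair {a b c d : Fin n} (h : ({a} + {b} : Multiset (Fin n)) = {c} + {d}) :
      a = c ∧ b = d ∨ a = d ∧ b = c := by
    rw [Multiset.singleton_add, Multiset.singleton_add, Multiset.cons_eq_cons] at h
    simp only [Multiset.singleton_inj] at h
    grind [Multiset.singleton_eq_cons_iff]
  have e₁ := pair (hrx.symm.trans ((hL r x).trans (by rw [hf, hg])))
  have e₂ := pair (hry.symm.trans ((hL r y).trans (by rw [hf, hg])))
  have e₃ := pair (hrx'.symm.trans ((hL r' x).trans (by rw [hf, hg])))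
  have e₄ := pair (hry'.symm.trans ((hL r' y).trans (by rw [hf, hg])))
  have fr := (hfr r).ne hxy
  have gr := (hgr r).ne hxy
  have fr' := (hfr r').ne hxy
  have gr' := (hgr r').ne hxy
  have fx := (hfc x).ne hr
  have gx := (hgc x).ne hr
  have fy := (hfc y).ne hr
  have gy := (hgc y).ne hr
  grind

lemma exists_not_separable_of_perm {m : ℕ} {x y z : Fin (m + 2)} (γ : Perm (Fin (m + 2)))
    (hxy : x ≠ y) (hxz : x ≠ z) (hyz : y ≠ z) (hγx : γ x = x) (hγz : γ z = y)
    (hγ : ∀ j, j ≠ x → γ j ≠ j) :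
    ∃ L, IsMultiLatin (m + 2) 2 L ∧ ¬ Separable (m + 2) 2 L := by
  let β : Perm (Fin (m + 2)) := swap x y * swap y z
  let δ : Perm (Fin (m + 2)) := swap x y * γ * swap x y
  have hβx : β x = y := by simp [β, swap_apply_of_ne_of_ne hxy hxz]
  have hβy : β y = z := by simp [β, swap_apply_of_ne_of_ne hxz.symm hyz.symm]
  have hβz : β z = x := by simp [β]
  have hβ (j) (hx : j ≠ x) (hy : j ≠ y) (hz : j ≠ z) : β j = j := by
    simp [β, swap_apply_of_ne_of_ne, hx, hy, hz]
  have hγyx : γ y ≠ x := fun h => hxy (γ.injective (hγx.trans h.symm))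
  have hγy : γ y ≠ y := hγ y hxy.symm
  have hδx : δ x = γ y := by simp [δ, swap_apply_of_ne_of_ne hγyx hγy]
  have hδy : δ y = y := by simp [δ, hγx]
  have hδz : δ z = x := by simp [δ, swap_apply_of_ne_of_ne hxz.symm hyz.symm, hγz]
  have hδ (j) (hx : j ≠ x) (hy : j ≠ y) : δ j ≠ j := fun h => by
    have : γ j = j := by
      simpa [δ, swap_apply_of_ne_of_ne hx hy, swap_apply_eq_iff] using h
    exact hγ j hx this
  obtain ⟨L, hL, h0, h1⟩ := exists_isMultiLatin_extending_two_rows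
    (fun j => {(1 : Perm (Fin (m + 2))) j} + {β j}) (fun j => {γ j} + {δ j}) (by simp) (by simp)
    (fun s => by simp only [Multiset.count_add, Finset.sum_add_distrib, sum_count_singleton_perm])
    (fun s => by simp only [Multiset.count_add, Finset.sum_add_distrib, sum_count_singleton_perm])
    (fun j s => by
      simp only [Multiset.count_add, Multiset.count_singleton, Perm.one_apply]
      have := hδ j
      have := hγ j
      by_cases hx : j = x
      · subst hx; grind
      by_cases hy : j = y
      · subst hy; grind
      by_cases hz : j = z
      · subst hz; grind
      have := hβ j hx hy hz
      grind)
  refine ⟨L, hL, not_separable_of_pattern (r := 0) (r' := 1) (z := z) (a := γ y) ?_ hxy ?_ ?_ ?_ ?_⟩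
  · simp
  · simp [h0, hβx]
  · simp [h0, hβy]
  · simp [h1, hγx, hδx]
  · simp [h1, hδy]

lemma exists_not_separable (m : ℕ) :
    ∃ L, IsMultiLatin (m + 3) 2 L ∧ ¬ Separable (m + 3) 2 L := by
  refine exists_not_separable_of_perm (x := 0) (y := Fin.succ 0) (z := Fin.succ (Fin.last (m + 1)))
    (Perm.decomposeFin.symm (0, finRotate (m + 2)))
    (Fin.succ_ne_zero _).symm (Fin.succ_ne_zero _).symm ?_ ?_ ?_ ?_
  · simp [Fin.ext_iff]
  · simp
  · simp [-Fin.succ_last]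
  · intro j hj
    obtain ⟨i, rfl⟩ := Fin.exists_succ_eq.2 hj
    simp

lemma separable_one {L : Fin 1 → Fin 1 → Multiset (Fin 1)} (hL : IsMultiLatin 1 2 L) :
    Separable 1 2 L := by
  refine ⟨1, 1, one_pos, one_pos, rfl, fun _ _ => {0}, fun _ _ => {0}, ?_, ?_, fun i j => ?_⟩
  · simp [IsMultiLatin, Fin.forall_fin_one]
  · simp [IsMultiLatin, Fin.forall_fin_one]
  · ext s
    have := hL.2.1 i s
    fin_cases s
    fin_cases j
    simpa using this

lemma separable_two {L : Fin 2 → Fin 2 → Multiset (Fin 2)} (hL : IsMultiLatin 2 2 L) :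
    Separable 2 2 L := by
  have hA : IsMultiLatin 2 1 fun i j => {i + j} := by unfold IsMultiLatin; decide
  have hB : IsMultiLatin 2 1 fun i j => {i + j + 1} := by unfold IsMultiLatin; decide
  obtain ⟨hcell, hrow, hcol⟩ := hL
  have hcount (i j) : (L i j).count 0 + (L i j).count 1 = 2 := by
    rw [← Fin.sum_univ_two fun s => (L i j).count s, Multiset.sum_count_eq_card (by simp), hcell]
  simp only [Fin.sum_univ_two, Fin.forall_fin_two] at hrow hcol hcount
  have hc : (L 0 0).count 0 = 0 ∨ (L 0 0).count 0 = 1 ∨ (L 0 0).count 0 = 2 := by omega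
  rcases hc with hc | hc | hc
  · refine ⟨1, 1, one_pos, one_pos, rfl, _, _, hB, hB, fun i j => Multiset.ext.2 fun s => ?_⟩
    revert i j s
    simp +decide only [Fin.forall_fin_two, Multiset.count_add, Multiset.count_singleton, if_true,
      if_false]
    omega
  · refine ⟨1, 1, one_pos, one_pos, rfl, _, _, hA, hB, fun i j => Multiset.ext.2 fun s => ?_⟩
    revert i j s
    simp +decide only [Fin.forall_fin_two, Multiset.count_add, Multiset.count_singleton, if_true,
      if_false]
    omega
  · refine ⟨1, 1, one_pos, one_pos, rfl, _, _, hA, hA, fun i j => Multiset.ext.2 fun s => ?_⟩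
    revert i j s
    simp +decide only [Fin.forall_fin_two, Multiset.count_add, Multiset.count_singleton, if_true,
      if_false]
    omega

/-- There exists a non-separable `2`-latin square of order `n` if and only if `n ≥ 3`. -/
theorem stmt_7 (n : ℕ) (hn : 0 < n) :
    (∃ L : Fin n → Fin n → Multiset (Fin n), IsMultiLatin n 2 L ∧ ¬ Separable n 2 L) ↔
      3 ≤ n := by
  refine ⟨fun ⟨L, hL, hsep⟩ => ?_, fun h => ?_⟩
  · by_contra! h
    interval_cases n
    · exact hsep (separable_one hL)
    · exact hsep (separable_two hL)
  · obtain ⟨m, rfl⟩ := Nat.exists_eq_add_of_le' h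
    exact exists_not_separable m
end

section
/- For every integer k ≥ 3, there exists a non-separable k-latin square of order k+2. -/
/-- The index type for rows, columns and symbols: `ZMod k` together with two extra points. -/
abbrev ExtIndex (k : ℕ) : Type := Option (Option (ZMod k))

/-- The multiplicities (row, column, symbol) of a non-separable `k`-latin square. The rows `none`
and `some none` force non-separability; the remaining rows spread the remaining demand evenly. -/
def nonsepMult (k : ℕ) : ExtIndex k → ExtIndex k → ExtIndex k → ℤ
  | none, none, some (some _) => 1
  | none, none, _ => 0
  | none, some none, some none => k
  | none, some none, _ => 0
  | none, some (some _), none => 1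
  | none, some (some _), some none => 0
  | none, some (some j), some (some t) => if t = j then (k : ℤ) - 1 else 0
  | some none, none, some none => k
  | some none, none, _ => 0
  | some none, some none, none => k
  | some none, some none, _ => 0
  | some none, some (some j), some (some t) =>
      (if t = j then 1 else 0) + (if t = j - 1 then (k : ℤ) - 1 else 0)
  | some none, some (some _), _ => 0
  | some (some _), none, none => 1
  | some (some _), none, some none => 0
  | some (some r), none, some (some t) => 1 - if t = r then 1 else 0
  | some (some _), some none, some (some _) => 1
  | some (some _), some none, _ => 0
  | some (some _), some (some _), some none => 1
  | some (some r), some (some j), none => 1 - if r = j - 1 then 1 else 0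
  | some (some r), some (some j), some (some t) =>
      1 - (if t = j then 1 else 0) - (if t = j - 1 then 1 else 0)
        + if t = j - 1 then (if r = j - 1 then 1 else 0) else 0

lemma nonsepMult_nonneg {k : ℕ} (hk : 2 ≤ k) (i j s : ExtIndex k) : 0 ≤ nonsepMult k i j s := by
  have : Fact (1 < k) := ⟨hk⟩
  rcases i with _ | _ | i <;> rcases j with _ | _ | j <;> rcases s with _ | _ | s <;>
    simp only [nonsepMult] <;> (try split_ifs) <;> first | omega | skip
  all_goals simp_all

lemma sum_cell_nonsepMult {k : ℕ} [NeZero k] (i j : ExtIndex k) :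
    ∑ s, nonsepMult k i j s = k := by
  rcases i with _ | _ | i <;> rcases j with _ | _ | j <;>
    simp [nonsepMult, Fintype.sum_option, Finset.sum_add_distrib, Finset.sum_sub_distrib,
      ZMod.card]
  ring

lemma sum_row_nonsepMult {k : ℕ} [NeZero k] (i s : ExtIndex k) :
    ∑ j, nonsepMult k i j s = k := by
  rcases i with _ | _ | i <;> rcases s with _ | _ | s <;>
    simp [nonsepMult, Fintype.sum_option, Finset.sum_add_distrib, Finset.sum_sub_distrib,
      ZMod.card, eq_sub_iff_add_eq]
  simp only [eq_comm (a := s) (b := i)]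
  ring

lemma sum_col_nonsepMult {k : ℕ} [NeZero k] (j s : ExtIndex k) :
    ∑ i, nonsepMult k i j s = k := by
  rcases j with _ | _ | j <;> rcases s with _ | _ | s <;>
    simp [nonsepMult, Fintype.sum_option, Finset.sum_add_distrib, Finset.sum_sub_distrib,
      ZMod.card]
  split_ifs <;> simp

lemma ZMod.eq_of_forall_add_one_eq {k : ℕ} [NeZero k] {β : Type*} {f : ZMod k → β}
    (hf : ∀ x, f (x + 1) = f x) (x : ZMod k) : f x = f 0 := by
  have h (n : ℕ) : f n = f 0 := by
    induction n with
    | zero => simp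
    | succ n ih => rw [Nat.cast_succ, hf, ih]
  simpa using h x.val

/-- The common line sum of an array dominated by `nonsepMult` is a multiple of `k`. -/
lemma dvd_of_le_nonsepMult {k d : ℕ} [NeZero k] (hk : 2 ≤ k)
    (f : ExtIndex k → ExtIndex k → ExtIndex k → ℕ)
    (hle : ∀ i j s, (f i j s : ℤ) ≤ nonsepMult k i j s)
    (hcell : ∀ i j, ∑ s, f i j s = d) (hrow : ∀ i s, ∑ j, f i j s = d)
    (hcol : ∀ j s, ∑ i, f i j s = d) : k ∣ d := by
  have : Fact (1 < k) := ⟨hk⟩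
  have hz {i j s : ExtIndex k} (h : nonsepMult k i j s = 0) : f i j s = 0 := by
    have := hle i j s
    omega
  have hstep (t : ZMod k) :
      f none none (some (some (t + 1))) = f none none (some (some t)) := by
    have hrow₀ (t : ZMod k) : f none none (some (some t)) +
        f none (some (some t)) (some (some t)) = d := by
      have h := hrow none (some (some t))
      rw [Fintype.sum_option, Fintype.sum_option, hz (j := some none) (by simp [nonsepMult]),
        Finset.sum_eq_single t (fun j _ hj ↦ hz (by simp [nonsepMult, hj.symm]))
          (by simp)] at h
      omega
    have hcol₀ (t : ZMod k) : f none (some (some t)) (some (some t)) +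
        f (some none) (some (some t)) (some (some t)) = d := by
      have h := hcol (some (some t)) (some (some t))
      rw [Fintype.sum_option, Fintype.sum_option,
        Finset.sum_eq_zero (fun r _ ↦ hz (by simp [nonsepMult, eq_sub_iff_add_eq]))] at h
      omega
    have hrow₁ : f (some none) (some (some t)) (some (some t)) +
        f (some none) (some (some (t + 1))) (some (some t)) = d := by
      have h := hrow (some none) (some (some t))
      rw [Fintype.sum_option, Fintype.sum_option, hz (j := none) (by simp [nonsepMult]),
        hz (j := some none) (by simp [nonsepMult]),
        Finset.sum_eq_add t (t + 1) (by simp)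
          (fun j _ hj ↦ hz (by simp [nonsepMult, eq_sub_iff_add_eq, hj.1.symm, hj.2.symm]))
          (by simp) (by simp)] at h
      omega
    have hcell₁ : f (some none) (some (some (t + 1))) (some (some (t + 1))) +
        f (some none) (some (some (t + 1))) (some (some t)) = d := by
      have h := hcell (some none) (some (some (t + 1)))
      rw [Fintype.sum_option, Fintype.sum_option, hz (s := none) (by simp [nonsepMult]),
        hz (s := some none) (by simp [nonsepMult]),
        Finset.sum_eq_add (t + 1) t (by simp)
          (fun j _ hj ↦ hz (by simp [nonsepMult, hj.1, hj.2]))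
          (by simp) (by simp)] at h
      omega
    have := hrow₀ t
    have := hrow₀ (t + 1)
    have := hcol₀ t
    have := hcol₀ (t + 1)
    omega
  have h := hcell none none
  rw [Fintype.sum_option, Fintype.sum_option, hz (s := none) (by simp [nonsepMult]),
    hz (s := some none) (by simp [nonsepMult]),
    Finset.sum_congr rfl fun t _ ↦ ZMod.eq_of_forall_add_one_eq
      (f := fun t ↦ f none none (some (some t))) hstep t] at h
  simp only [Finset.sum_const, Finset.card_univ, ZMod.card, smul_eq_mul, zero_add] at h
  exact ⟨_, h.symm⟩

lemma Multiset.count_sum_replicate {α : Type*} [Fintype α] [DecidableEq α] (g : α → ℕ) (a : α) :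
    (∑ b, Multiset.replicate (g b) b).count a = g a := by
  simp [Multiset.count_sum', Multiset.count_replicate]

/-- For every `k ≥ 3` there exists a non-separable `k`-latin square of order `k + 2`. -/
theorem stmt_8 (k : ℕ) (hk : 3 ≤ k) :
    ∃ L : Fin (k + 2) → Fin (k + 2) → Multiset (Fin (k + 2)),
      IsMultiLatin (k + 2) k L ∧ ¬ Separable (k + 2) k L := by
  have : NeZero k := ⟨by omega⟩
  let e : Fin (k + 2) ≃ ExtIndex k :=
    (Fintype.equivFinOfCardEq (by simp [ZMod.card])).symm
  let m (i j s : Fin (k + 2)) : ℕ := (nonsepMult k (e i) (e j) (e s)).toNat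
  have hm (i j s) : (m i j s : ℤ) = nonsepMult k (e i) (e j) (e s) :=
    Int.toNat_of_nonneg (nonsepMult_nonneg (by omega) _ _ _)
  let L (i j : Fin (k + 2)) : Multiset (Fin (k + 2)) := ∑ s, Multiset.replicate (m i j s) s
  have hL (i j s) : (L i j).count s = m i j s := Multiset.count_sum_replicate _ _
  refine ⟨L, ⟨fun i j ↦ ?_, fun i s ↦ ?_, fun j s ↦ ?_⟩, ?_⟩
  · rw [← Multiset.sum_count_eq_card (s := Finset.univ) (by simp)]
    zify
    simp only [hL, hm]
    rw [e.sum_comp (fun s ↦ nonsepMult k (e i) (e j) s), sum_cell_nonsepMult]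
  · zify
    simp only [hL, hm]
    rw [e.sum_comp (fun j ↦ nonsepMult k (e i) j (e s)), sum_row_nonsepMult]
  · zify
    simp only [hL, hm]
    rw [e.sum_comp (fun i ↦ nonsepMult k i (e j) (e s)), sum_col_nonsepMult]
  · rintro ⟨k₁, k₂, hk₁, hk₂, hk₁₂, L₁, L₂, ⟨hcell, hrow, hcol⟩, -, hjoin⟩
    have hdvd : k ∣ k₁ := by
      refine dvd_of_le_nonsepMult (by omega)
        (fun i j s ↦ (L₁ (e.symm i) (e.symm j)).count (e.symm s)) (fun i j s ↦ ?_)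
        (fun i j ↦ ?_) (fun i s ↦ ?_) (fun j s ↦ ?_)
      · have h := hm (e.symm i) (e.symm j) (e.symm s)
        rw [← hL, hjoin, Multiset.count_add] at h
        simp only [Equiv.apply_symm_apply] at h
        omega
      · rw [e.symm.sum_comp (fun s ↦ (L₁ (e.symm i) (e.symm j)).count s),
          Multiset.sum_count_eq_card (by simp), hcell]
      · rw [e.symm.sum_comp (fun j ↦ (L₁ (e.symm i) j).count (e.symm s)), hrow]
      · rw [e.symm.sum_comp (fun i ↦ (L₁ i (e.symm j)).count (e.symm s)), hcol]
    have := Nat.le_of_dvd hk₁ hdvd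
    omega
end

section
/- For every integer k ≥ 3 and every integer s with 1 ≤ s ≤ k−1, there exists a non-separable k-latin square of order k+s+2. -/
/-- A nonnegative integer matrix all of whose row and column sums equal `d > 0`
has a permutation in its support. -/
theorem exists_perm_pos {α : Type*} [Fintype α] [DecidableEq α] {d : ℕ} (hd : 0 < d)
    (D : α → α → ℕ) (hr : ∀ i, ∑ j, D i j = d) (hc : ∀ j, ∑ i, D i j = d) :
    ∃ σ : Equiv.Perm α, ∀ i, 0 < D i (σ i) := by
  let t : α → Finset α := fun i => Finset.univ.filter fun j => 0 < D i j
  have hall : ∀ A : Finset α, A.card ≤ (A.biUnion t).card := by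
    intro A
    have h1 : ∀ i ∈ A, ∑ j ∈ A.biUnion t, D i j = d := by
      intro i hi
      rw [← hr i]
      refine Finset.sum_subset (Finset.subset_univ _) fun j _ hj => ?_
      by_contra h
      exact hj (Finset.mem_biUnion.2 ⟨i, hi, by simpa [t] using Nat.pos_of_ne_zero h⟩)
    have h2 : A.card * d ≤ (A.biUnion t).card * d := by
      calc A.card * d = ∑ i ∈ A, ∑ j ∈ A.biUnion t, D i j := by
            rw [Finset.sum_congr rfl h1, Finset.sum_const, smul_eq_mul]
        _ = ∑ j ∈ A.biUnion t, ∑ i ∈ A, D i j := Finset.sum_comm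
        _ ≤ ∑ j ∈ A.biUnion t, ∑ i, D i j :=
            Finset.sum_le_sum fun j _ => Finset.sum_le_sum_of_subset (Finset.subset_univ _)
        _ = (A.biUnion t).card * d := by
            rw [Finset.sum_congr rfl fun j _ => hc j, Finset.sum_const, smul_eq_mul]
    exact Nat.le_of_mul_le_mul_right h2 hd
  obtain ⟨f, hf, hft⟩ := (Finset.all_card_le_biUnion_card_iff_exists_injective t).1 hall
  exact ⟨Equiv.ofBijective f (Finite.injective_iff_bijective.1 hf),
    fun i => by simpa [t] using hft i⟩

/-- A nonnegative integer matrix with all line sums `k + d` splits as the sum of a matrix with all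
line sums `k` and a matrix with all line sums `d`. -/
theorem exists_add_of_line_sums {α : Type*} [Fintype α] [DecidableEq α] (k d : ℕ)
    (D : α → α → ℕ) (hr : ∀ i, ∑ j, D i j = k + d) (hc : ∀ j, ∑ i, D i j = k + d) :
    ∃ E F : α → α → ℕ, (∀ i j, E i j + F i j = D i j) ∧
      (∀ i, ∑ j, E i j = k) ∧ (∀ j, ∑ i, E i j = k) ∧
      (∀ i, ∑ j, F i j = d) ∧ (∀ j, ∑ i, F i j = d) := by
  induction k generalizing D with
  | zero => exact ⟨fun _ _ => 0, D, by simp, by simp, by simp, by simpa using hr, by simpa using hc⟩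
  | succ k ih =>
    obtain ⟨σ, hσ⟩ := exists_perm_pos (by omega) D hr hc
    let P : α → α → ℕ := fun i j => if σ i = j then 1 else 0
    have hPD : ∀ i j, P i j + (D i j - P i j) = D i j := by
      intro i j
      apply Nat.add_sub_cancel'
      by_cases h : σ i = j
      · subst h
        simpa [P] using Nat.one_le_iff_ne_zero.2 (hσ i).ne'
      · simp [P, h]
    have hPr : ∀ i, ∑ j, P i j = 1 := by simp [P]
    have hPc : ∀ j, ∑ i, P i j = 1 := by
      intro j
      simp [P, ← Equiv.eq_symm_apply]
    obtain ⟨E, F, hEF, h1, h2, h3, h4⟩ := ih (fun i j => D i j - P i j)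
      (fun i => by
        have h := Finset.sum_congr rfl fun j (_ : j ∈ Finset.univ) => hPD i j
        rw [Finset.sum_add_distrib, hPr, hr] at h
        omega)
      (fun j => by
        have h := Finset.sum_congr rfl fun i (_ : i ∈ Finset.univ) => hPD i j
        rw [Finset.sum_add_distrib, hPc, hc] at h
        omega)
    refine ⟨fun i j => P i j + E i j, F, fun i j => ?_, fun i => ?_, fun j => ?_, h3, h4⟩
    · rw [add_assoc, hEF, hPD]
    · rw [Finset.sum_add_distrib, hPr, h1, add_comm]
    · rw [Finset.sum_add_distrib, hPc, h2, add_comm]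

/-- A nonnegative integer matrix with all line sums `m * k` is the sum of `m` matrices with all
line sums `k`. -/
theorem exists_sum_of_line_sums {α : Type*} [Fintype α] [DecidableEq α] (k m : ℕ)
    (D : α → α → ℕ) (hr : ∀ i, ∑ j, D i j = m * k) (hc : ∀ j, ∑ i, D i j = m * k) :
    ∃ E : Fin m → α → α → ℕ, (∀ i j, ∑ r, E r i j = D i j) ∧
      (∀ r i, ∑ j, E r i j = k) ∧ (∀ r j, ∑ i, E r i j = k) := by
  induction m generalizing D with
  | zero =>
    refine ⟨fun _ _ _ => 0, fun i j => ?_, fun r => r.elim0, fun r => r.elim0⟩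
    have h := hr i
    rw [zero_mul, Finset.sum_eq_zero_iff] at h
    simp [h j (Finset.mem_univ j)]
  | succ m ih =>
    obtain ⟨E, F, hEF, h1, h2, h3, h4⟩ := exists_add_of_line_sums k (m * k) D
      (fun i => by rw [hr]; ring) (fun j => by rw [hc]; ring)
    obtain ⟨G, g1, g2, g3⟩ := ih F h3 h4
    refine ⟨Fin.cons E G, fun i j => ?_, fun r => ?_, fun r => ?_⟩
    · simp [Fin.sum_univ_succ, g1, hEF]
    · cases r using Fin.cases <;> simp [h1, g2]
    · cases r using Fin.cases <;> simp [h2, g3]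

/-- A three-dimensional array of multiplicities with all line sums equal to `k` is the array of
multiplicities of a `k`-latin square. -/
theorem exists_isMultiLatin_of_count {n k : ℕ} (c : Fin n → Fin n → Fin n → ℕ)
    (hcell : ∀ i j, ∑ s, c i j s = k) (hrow : ∀ i s, ∑ j, c i j s = k)
    (hcol : ∀ j s, ∑ i, c i j s = k) :
    ∃ L : Fin n → Fin n → Multiset (Fin n),
      IsMultiLatin n k L ∧ ∀ i j s, (L i j).count s = c i j s := by
  let L : Fin n → Fin n → Multiset (Fin n) := fun i j => ∑ s, Multiset.replicate (c i j s) s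
  have hL : ∀ i j s, (L i j).count s = c i j s := by
    intro i j s
    simp [L, Multiset.count_sum', Multiset.count_replicate]
  refine ⟨L, ⟨fun i j => ?_, fun i s => ?_, fun j s => ?_⟩, hL⟩
  · simp [L, hcell]
  · simp [hL, hrow]
  · simp [hL, hcol]

/-- Multiplicities (column, symbol) in the first row of the non-separable rectangle. -/
def firstRow (k s : ℕ) : Fin k ⊕ Fin (s + 2) → Fin k ⊕ Fin (s + 2) → ℕ
  | .inl i, .inl i' => if i = i' then k - 1 else 0
  | .inl _, .inr j => if j = 0 then 1 else 0
  | .inr j, .inl _ => if j = 0 then 1 else 0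
  | .inr j, .inr j' => if j = 0 then 0 else if j = j' then k else 0

/-- Multiplicities (column, symbol) in the second row of the non-separable rectangle. -/
def secondRow (k s : ℕ) : Fin k ⊕ Fin (s + 2) → Fin k ⊕ Fin (s + 2) → ℕ
  | .inl i, .inl i' =>
      (if i = i' then 1 else 0) + (if finRotate k i = i' then k - 1 else 0)
  | .inl _, .inr _ => 0
  | .inr _, .inl _ => 0
  | .inr j, .inr j' => if finRotate (s + 2) j = j' then k else 0

theorem sum_firstRow_symbols {k : ℕ} (s : ℕ) (hk : 1 ≤ k) (p : Fin k ⊕ Fin (s + 2)) :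
    ∑ q, firstRow k s p q = k := by
  rcases p with i | j
  · simp [firstRow, hk]
  · by_cases h : j = 0 <;> simp [firstRow, h]

theorem sum_firstRow_columns {k : ℕ} (s : ℕ) (hk : 1 ≤ k) (q : Fin k ⊕ Fin (s + 2)) :
    ∑ p, firstRow k s p q = k := by
  rcases q with i | j
  · simp [firstRow, hk]
  · have h2 : ∀ x : Fin (s + 2), (if x = 0 then 0 else if x = j then k else 0)
        = if x = j then (if j = 0 then 0 else k) else 0 := by
      intro x
      split_ifs <;> simp_all
    simp only [Fintype.sum_sum_type, firstRow, h2]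
    by_cases h : j = 0 <;> simp [h]

theorem sum_secondRow_symbols {k : ℕ} (s : ℕ) (hk : 1 ≤ k) (p : Fin k ⊕ Fin (s + 2)) :
    ∑ q, secondRow k s p q = k := by
  rcases p with i | j
  · simp [secondRow, Finset.sum_add_distrib, -finRotate_apply]
    omega
  · simp [secondRow, -finRotate_apply]

theorem sum_secondRow_columns {k : ℕ} (s : ℕ) (hk : 1 ≤ k) (q : Fin k ⊕ Fin (s + 2)) :
    ∑ p, secondRow k s p q = k := by
  rcases q with i | j
  · simp [secondRow, Finset.sum_add_distrib, ← Equiv.eq_symm_apply, -finRotate_apply]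
    omega
  · simp [secondRow, ← Equiv.eq_symm_apply, -finRotate_apply]

theorem finRotate_ne_self {k : ℕ} (hk : 2 ≤ k) (i : Fin k) : finRotate k i ≠ i := by
  obtain ⟨m, rfl⟩ : ∃ m, k = m + 2 := ⟨k - 2, by omega⟩
  simp

theorem firstRow_add_secondRow_le {k : ℕ} (s : ℕ) (hk : 2 ≤ k) (p q : Fin k ⊕ Fin (s + 2)) :
    firstRow k s p q + secondRow k s p q ≤ k := by
  rcases p with i | j <;> rcases q with i' | j'
  · by_cases h : i = i'
    · subst h
      simp only [firstRow, secondRow, finRotate_ne_self hk i, if_true, if_false]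
      omega
    · simp only [firstRow, secondRow, h, if_false]
      split_ifs <;> omega
  · simp only [firstRow, secondRow]
    split_ifs <;> omega
  · simp only [firstRow, secondRow]
    split_ifs <;> omega
  · by_cases h : j = j'
    · subst h
      simp only [firstRow, secondRow, finRotate_ne_self (by omega : 2 ≤ s + 2) j, if_false]
      split_ifs <;> omega
    · simp only [firstRow, secondRow, h, if_false]
      split_ifs <;> omega

/-- An array whose first two rows are `firstRow` and `secondRow` does not dominate any array with
constant line sums strictly between `0` and `k`. -/
theorem not_line_sums_of_le {k s m k₁ : ℕ} (hk : 2 ≤ k) (h0 : 0 < k₁) (h1 : k₁ < k)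
    (E x : Fin m → Fin k ⊕ Fin (s + 2) → Fin k ⊕ Fin (s + 2) → ℕ)
    (u v : Fin k ⊕ Fin (s + 2) → Fin k ⊕ Fin (s + 2) → ℕ)
    (hE : ∀ p q, firstRow k s p q + (secondRow k s p q + ∑ r, E r p q) = k)
    (hu : ∀ p q, u p q ≤ firstRow k s p q) (hv : ∀ p q, v p q ≤ secondRow k s p q)
    (hx : ∀ r p q, x r p q ≤ E r p q)
    (hucell : ∀ p, ∑ q, u p q = k₁) (hvcell : ∀ p, ∑ q, v p q = k₁)
    (hurow : ∀ q, ∑ p, u p q = k₁) (hvrow : ∀ q, ∑ p, v p q = k₁)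
    (hcol : ∀ p q, u p q + (v p q + ∑ r, x r p q) = k₁) : False := by
  have hu0 : ∀ {p q}, firstRow k s p q = 0 → u p q = 0 := fun h => Nat.le_zero.1 (h ▸ hu _ _)
  have hv0 : ∀ {p q}, secondRow k s p q = 0 → v p q = 0 := fun h => Nat.le_zero.1 (h ▸ hv _ _)
  have row_first : ∀ i, u (.inl i) (.inl i) + u (.inr 0) (.inl i) = k₁ := by
    intro i
    rw [← hurow (.inl i), Fintype.sum_sum_type]
    congr 1
    · exact (Finset.sum_eq_single_of_mem i (Finset.mem_univ _)
        fun j _ hj => hu0 (p := .inl j) (q := .inl i) (by simp [firstRow, hj])).symm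
    · exact (Finset.sum_eq_single_of_mem 0 (Finset.mem_univ _)
        fun j _ hj => hu0 (p := .inr j) (q := .inl i) (by simp [firstRow, hj])).symm
  have col : ∀ i, u (.inl i) (.inl i) + v (.inl i) (.inl i) = k₁ := by
    intro i
    have hx0 : ∑ r, x r (.inl i) (.inl i) = 0 := by
      have hle := Finset.sum_le_sum fun r (_ : r ∈ Finset.univ) => hx r (.inl i) (.inl i)
      have h := hE (.inl i) (.inl i)
      simp only [firstRow, secondRow, if_true, finRotate_ne_self hk i, if_false] at h
      omega
    have h := hcol (.inl i) (.inl i)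
    omega
  have cell : ∀ i, v (.inl i) (.inl i) + v (.inl i) (.inl (finRotate k i)) = k₁ := by
    intro i
    rw [← hvcell (.inl i), Fintype.sum_sum_type,
      Finset.sum_eq_zero fun j _ => hv0 (q := .inr j) rfl, add_zero]
    refine (Finset.sum_eq_add_of_mem _ _ (Finset.mem_univ _) (Finset.mem_univ _)
      (finRotate_ne_self hk i).symm fun j _ hj => hv0 (p := .inl i) (q := .inl j) ?_).symm
    simp only [secondRow, hj.1.symm, hj.2.symm, if_false]
  have row_second : ∀ i, v (.inl i) (.inl (finRotate k i)) +
      v (.inl (finRotate k i)) (.inl (finRotate k i)) = k₁ := by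
    intro i
    rw [← hvrow (.inl (finRotate k i)), Fintype.sum_sum_type,
      Finset.sum_eq_zero fun j _ => hv0 (p := .inr j) rfl, add_zero]
    refine (Finset.sum_eq_add_of_mem _ _ (Finset.mem_univ _) (Finset.mem_univ _)
      (finRotate_ne_self hk i).symm fun j _ hj => hv0 (p := .inl j) ?_).symm
    simp only [secondRow, hj.2, (finRotate k).injective.ne hj.1, if_false]
  have step : ∀ i, u (.inr 0) (.inl (finRotate k i)) = u (.inr 0) (.inl i) := by
    intro i
    have := row_first i
    have := row_first (finRotate k i)
    have := col i
    have := col (finRotate k i)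
    have := cell i
    have := row_second i
    omega
  obtain ⟨l, rfl⟩ : ∃ l, k = l + 1 := ⟨k - 1, by omega⟩
  have const : ∀ i, u (.inr 0) (.inl i) = u (.inr 0) (.inl 0) := by
    intro i
    induction i using Fin.induction with
    | zero => rfl
    | succ i ih =>
      rw [← ih, ← step i.castSucc, finRotate_apply, Fin.coeSucc_eq_succ]
  have total : (l + 1) * u (.inr 0) (.inl 0) = k₁ := by
    rw [← hucell (.inr 0), Fintype.sum_sum_type,
      Finset.sum_eq_zero fun j _ => hu0 (q := .inr j) (by simp [firstRow])]
    simp [const]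
  have hle : u (.inr 0) (.inl 0) ≤ 1 := hu _ _
  interval_cases h : u (.inr 0) (.inl 0) <;> omega

/-- For every `k ≥ 3` and every `1 ≤ s ≤ k - 1`, there exists a non-separable
`k`-latin square of order `k + s + 2`. -/
theorem stmt_9 (k s : ℕ) (hk : 3 ≤ k) (hs1 : 1 ≤ s) (hs2 : s ≤ k - 1) :
    ∃ L : Fin (k + s + 2) → Fin (k + s + 2) → Multiset (Fin (k + s + 2)),
      IsMultiLatin (k + s + 2) k L ∧ ¬ Separable (k + s + 2) k L := by
  have hk1 : 1 ≤ k := by omega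
  have hk2 : 2 ≤ k := by omega
  let e : Fin (k + s + 2) ≃ Fin k ⊕ Fin (s + 2) := (finSumFinEquiv (m := k) (n := s + 2)).symm
  let A := firstRow k s
  let B := secondRow k s
  have hD : ∀ p q, A p q + B p q + (k - (A p q + B p q)) = k := fun p q =>
    Nat.add_sub_cancel' (firstRow_add_secondRow_le s hk2 p q)
  obtain ⟨E, hE, hEcell, hErow⟩ := exists_sum_of_line_sums k (k + s)
    (fun p q => k - (A p q + B p q))
    (fun p => by
      have h := Finset.sum_congr rfl fun q (_ : q ∈ Finset.univ) => hD p q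
      simp only [Finset.sum_add_distrib, A, B, sum_firstRow_symbols s hk1,
        sum_secondRow_symbols s hk1, Finset.sum_const, Finset.card_univ, Fintype.card_sum,
        Fintype.card_fin, smul_eq_mul] at h ⊢
      linarith)
    (fun q => by
      have h := Finset.sum_congr rfl fun p (_ : p ∈ Finset.univ) => hD p q
      simp only [Finset.sum_add_distrib, A, B, sum_firstRow_columns s hk1,
        sum_secondRow_columns s hk1, Finset.sum_const, Finset.card_univ, Fintype.card_sum,
        Fintype.card_fin, smul_eq_mul] at h ⊢
      linarith)
  have hsum : ∀ p q, A p q + (B p q + ∑ r, E r p q) = k := by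
    intro p q
    rw [hE, ← add_assoc, hD]
  let C : Fin (k + s + 2) → Fin k ⊕ Fin (s + 2) → Fin k ⊕ Fin (s + 2) → ℕ :=
    Fin.cons A (Fin.cons B E)
  have hCcell : ∀ i p, ∑ q, C i p q = k := by
    intro i p
    refine Fin.cases (sum_firstRow_symbols s hk1 p) (fun i => ?_) i
    exact Fin.cases (sum_secondRow_symbols s hk1 p) (fun i => hEcell i p) i
  have hCrow : ∀ i q, ∑ p, C i p q = k := by
    intro i q
    refine Fin.cases (sum_firstRow_columns s hk1 q) (fun i => ?_) i
    exact Fin.cases (sum_secondRow_columns s hk1 q) (fun i => hErow i q) i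
  obtain ⟨L, hL, hcount⟩ := exists_isMultiLatin_of_count (k := k)
    (fun i j t => C i (e j) (e t))
    (fun i j => (Equiv.sum_comp e _).trans (hCcell i (e j)))
    (fun i t => (Equiv.sum_comp e fun p => C i p (e t)).trans (hCrow i (e t)))
    (fun j t => by
      rw [Fin.sum_univ_succ, Fin.sum_univ_succ]
      exact hsum (e j) (e t))
  refine ⟨L, hL, ?_⟩
  rintro ⟨k₁, k₂, h1, h2, h12, L₁, L₂, ⟨hcell, hrow, hcol⟩, -, hadd⟩
  let X : Fin (k + s + 2) → Fin k ⊕ Fin (s + 2) → Fin k ⊕ Fin (s + 2) → ℕ :=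
    fun i p q => (L₁ i (e.symm p)).count (e.symm q)
  have hXC : ∀ i p q, X i p q ≤ C i p q := by
    intro i p q
    have h := hcount i (e.symm p) (e.symm q)
    rw [hadd, Multiset.count_add, e.apply_symm_apply, e.apply_symm_apply] at h
    exact h ▸ Nat.le_add_right _ _
  have hXcell : ∀ i p, ∑ q, X i p q = k₁ := by
    intro i p
    rw [← hcell i (e.symm p), ← Multiset.sum_count_eq_card fun a _ => Finset.mem_univ a]
    exact Equiv.sum_comp e.symm fun t => (L₁ i (e.symm p)).count t
  have hXrow : ∀ i q, ∑ p, X i p q = k₁ := by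
    intro i q
    rw [← hrow i (e.symm q)]
    exact Equiv.sum_comp e.symm fun j => (L₁ i j).count (e.symm q)
  refine not_line_sums_of_le hk2 h1 (by omega) E (fun r => X r.succ.succ) (X 0)
    (X (Fin.succ 0)) hsum (hXC 0) (hXC (Fin.succ 0)) (fun r => hXC r.succ.succ) (hXcell _)
    (hXcell _) (hXrow _) (hXrow _) fun p q => ?_
  rw [← hcol (e.symm p) (e.symm q), Fin.sum_univ_succ, Fin.sum_univ_succ]
end

section
/- For all integers k ≥ 3 and n ≥ k+2, there exists a non-separable k-latin square of order n. -/
/-- A square matrix of natural numbers all of whose row and column sums equal `d`. -/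
def HasLineSums {ι : Type*} [Fintype ι] (d : ℕ) (R : ι → ι → ℕ) : Prop :=
  (∀ i, ∑ j, R i j = d) ∧ ∀ j, ∑ i, R i j = d

namespace HasLineSums

variable {ι : Type*} [Fintype ι] {d e : ℕ} {R Q : ι → ι → ℕ}

theorem add (hR : HasLineSums d R) (hQ : HasLineSums e Q) :
    HasLineSums (d + e) (fun i j => R i j + Q i j) :=
  ⟨fun i => by rw [Finset.sum_add_distrib, hR.1, hQ.1],
    fun j => by rw [Finset.sum_add_distrib, hR.2, hQ.2]⟩

theorem sub (hR : HasLineSums d R) (hQ : HasLineSums e Q) (hle : ∀ i j, Q i j ≤ R i j) :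
    HasLineSums (d - e) (fun i j => R i j - Q i j) := by
  constructor
  · intro i
    rw [Finset.sum_tsub_distrib _ fun j _ => hle i j, hR.1, hQ.1]
  · intro j
    rw [Finset.sum_tsub_distrib _ fun i _ => hle i j, hR.2, hQ.2]

theorem const (k : ℕ) : HasLineSums (Fintype.card ι * k) (fun _ _ : ι => k) :=
  ⟨fun _ => by simp, fun _ => by simp⟩

variable [DecidableEq ι]

theorem perm (σ : Equiv.Perm ι) (c : ℕ) :
    HasLineSums c (fun i j => if σ i = j then c else 0) := by
  constructor
  · intro i
    simp
  · intro j
    simp [← Equiv.eq_symm_apply]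

/-- Hall's theorem for regular bipartite multigraphs. -/
theorem exists_perm (hR : HasLineSums d R) (hd : 0 < d) :
    ∃ σ : Equiv.Perm ι, ∀ i, 0 < R i (σ i) := by
  obtain ⟨f, hf, hfR⟩ := (Finset.all_card_le_biUnion_card_iff_exists_injective
    (fun i => Finset.univ.filter fun j => 0 < R i j)).1 (by
      intro S
      set U := S.biUnion fun i => Finset.univ.filter fun j => 0 < R i j with hU
      refine Nat.le_of_mul_le_mul_right ?_ hd
      calc S.card * d = ∑ i ∈ S, ∑ j, R i j := by simp [hR.1]
        _ = ∑ i ∈ S, ∑ j ∈ U, R i j := by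
          refine Finset.sum_congr rfl fun i hi => (Finset.sum_subset (Finset.subset_univ _) ?_).symm
          intro j _ hj
          by_contra h
          exact hj (Finset.mem_biUnion.2 ⟨i, hi, by simpa using Nat.pos_of_ne_zero h⟩)
        _ = ∑ j ∈ U, ∑ i ∈ S, R i j := Finset.sum_comm
        _ ≤ ∑ j ∈ U, ∑ i, R i j :=
          Finset.sum_le_sum fun j _ => Finset.sum_le_sum_of_subset (Finset.subset_univ _)
        _ = U.card * d := by simp [hR.2])
  refine ⟨Equiv.ofBijective f (Finite.injective_iff_bijective.1 hf), fun i => ?_⟩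
  simpa using hfR i

theorem exists_le (hR : HasLineSums d R) (he : e ≤ d) :
    ∃ Q, HasLineSums e Q ∧ ∀ i j, Q i j ≤ R i j := by
  induction e with
  | zero => exact ⟨fun _ _ => 0, by simp [HasLineSums], by simp⟩
  | succ e ih =>
    obtain ⟨Q, hQ, hle⟩ := ih (by omega)
    obtain ⟨σ, hσ⟩ := (hR.sub hQ hle).exists_perm (by omega)
    refine ⟨_, hQ.add (perm σ 1), fun i j => ?_⟩
    split_ifs with h
    · have := hσ i
      rw [h] at this
      omega
    · exact hle i j

/-- König's theorem: a regular bipartite multigraph of degree `m * k` splits into `m`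
regular factors of degree `k`. -/
theorem exists_decomposition {k : ℕ} (m : ℕ) (hR : HasLineSums (m * k) R) :
    ∃ Q : Fin m → ι → ι → ℕ, (∀ t, HasLineSums k (Q t)) ∧ ∀ i j, ∑ t, Q t i j = R i j := by
  induction m generalizing R with
  | zero =>
    refine ⟨fun t => t.elim0, fun t => t.elim0, fun i j => ?_⟩
    have h := hR.1 i
    rw [zero_mul, Finset.sum_eq_zero_iff] at h
    simp [h j (Finset.mem_univ j)]
  | succ m ih =>
    obtain ⟨P, hP, hle⟩ := hR.exists_le (e := k) (by nlinarith)
    have hsub := hR.sub hP hle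
    rw [Nat.succ_mul, Nat.add_sub_cancel] at hsub
    obtain ⟨Q, hQ, hsum⟩ := ih hsub
    refine ⟨Fin.cons P Q, Fin.cases hP hQ, fun i j => ?_⟩
    simp only [Fin.sum_univ_succ, Fin.cons_zero, Fin.cons_succ, hsum]
    exact Nat.add_sub_of_le (hle i j)

end HasLineSums

/-- The array of multisets in which the symbol `s` has multiplicity `T i j s` in cell `(i, j)`. -/
def multisetArray {n : ℕ} (T : Fin n → Fin n → Fin n → ℕ) (i j : Fin n) : Multiset (Fin n) :=
  ∑ s, Multiset.replicate (T i j s) s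

theorem count_multisetArray {n : ℕ} (T : Fin n → Fin n → Fin n → ℕ) (i j s : Fin n) :
    (multisetArray T i j).count s = T i j s := by
  simp [multisetArray, Multiset.count_sum', Multiset.count_replicate]

theorem isMultiLatin_multisetArray {n k : ℕ} {T : Fin n → Fin n → Fin n → ℕ}
    (hT : ∀ i, HasLineSums k (T i)) (hcol : ∀ j s, ∑ i, T i j s = k) :
    IsMultiLatin n k (multisetArray T) := by
  refine ⟨fun i j => ?_, fun i s => ?_, fun j s => ?_⟩
  · simp [multisetArray, (hT i).1]
  · simp [count_multisetArray, (hT i).2]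
  · simp [count_multisetArray, hcol]

theorem IsMultiLatin.sum_count {n k : ℕ} {L : Fin n → Fin n → Multiset (Fin n)}
    (hL : IsMultiLatin n k L) (i j : Fin n) : ∑ s, (L i j).count s = k := by
  rw [← hL.1 i j]
  exact Multiset.sum_count_eq_card fun _ _ => Finset.mem_univ _

/-- Two rows whose sum is at most `k` everywhere extend to a full array with line sums `k`. -/
theorem exists_completion_two_rows {m k : ℕ} {M₁ M₂ : Fin (m + 2) → Fin (m + 2) → ℕ}
    (h₁ : HasLineSums k M₁) (h₂ : HasLineSums k M₂) (hle : ∀ j s, M₁ j s + M₂ j s ≤ k) :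
    ∃ T : Fin (m + 2) → Fin (m + 2) → Fin (m + 2) → ℕ, T 0 = M₁ ∧ T 1 = M₂ ∧
      (∀ i, HasLineSums k (T i)) ∧ ∀ j s, ∑ i, T i j s = k := by
  have h := (HasLineSums.const (ι := Fin (m + 2)) k).sub (h₁.add h₂) hle
  rw [Fintype.card_fin, show (m + 2) * k - (k + k) = m * k by
    rw [add_mul, two_mul, Nat.add_sub_cancel]] at h
  obtain ⟨Q, hQ, hsum⟩ := h.exists_decomposition
  refine ⟨Fin.cons M₁ (Fin.cons M₂ Q), rfl, rfl,
    Fin.cases h₁ (Fin.cases h₂ hQ), fun j s => ?_⟩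
  simp only [Fin.sum_univ_succ, Fin.cons_zero, Fin.cons_succ, hsum]
  have := hle j s
  omega

/-- The first row, as a matrix indexed by columns and symbols: the sum of the `k`
transpositions `(k a)` with `a < k`. -/
def starRow (n k : ℕ) (j s : Fin n) : ℕ :=
  (if (j : ℕ) = k then (if (s : ℕ) < k then 1 else 0) else 0) +
    (if (s : ℕ) = k then (if (j : ℕ) < k then 1 else 0) else 0) +
    if j = s then (if (j : ℕ) < k then k - 1 else if (j : ℕ) = k then 0 else k) else 0

theorem starRow_comm (n k : ℕ) (j s : Fin n) : starRow n k j s = starRow n k s j := by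
  unfold starRow
  rcases eq_or_ne j s with rfl | h
  · rfl
  · rw [if_neg h, if_neg h.symm]
    omega

theorem hasLineSums_starRow {n k : ℕ} (hkn : k < n) : HasLineSums k (starRow n k) := by
  have key (j : Fin n) : ∑ s, starRow n k j s = k := by
    have e₁ : ∑ s : Fin n, (if (s : ℕ) < k then 1 else 0) = k := by
      rw [Fin.sum_univ_eq_sum_range (fun s => if s < k then 1 else 0), ← Finset.sum_filter,
        show (Finset.range n).filter (· < k) = Finset.range k by ext; simp; omega]
      simp
    have e₂ (c : ℕ) : ∑ s : Fin n, (if (s : ℕ) = k then c else 0) = c := by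
      rw [Fin.sum_univ_eq_sum_range (fun s => if s = k then c else 0)]
      simp [hkn]
    simp only [starRow, Finset.sum_add_distrib, e₂, Finset.sum_ite_eq, Finset.mem_univ, if_true]
    split_ifs <;> first | omega | (simp only [Finset.sum_const_zero]; omega)
  refine ⟨key, fun s => ?_⟩
  simp_rw [starRow_comm n k _ s]
  exact key s

/-- The permutation with cycles `(0 1 ... k-1)` and `(k k+1 ... n-1)`. -/
noncomputable def twoCycles (n k : ℕ) (hk : 0 < k) (hkn : k < n) : Equiv.Perm (Fin n) :=
  Equiv.ofBijective
    (fun i => ⟨if (i : ℕ) + 1 = k then 0 else if (i : ℕ) + 1 = n then k else i + 1, by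
      have := i.2
      split_ifs <;> omega⟩)
    (Finite.injective_iff_bijective.1 fun a b h => by
      have ha := a.2
      have hb := b.2
      simp only [Fin.mk.injEq] at h
      ext
      split_ifs at h <;> omega)

theorem val_twoCycles {n k : ℕ} (hk : 0 < k) (hkn : k < n) (i : Fin n) :
    (twoCycles n k hk hkn i : ℕ) =
      if (i : ℕ) + 1 = k then 0 else if (i : ℕ) + 1 = n then k else i + 1 := rfl

/-- The permutation fixing `0, ..., k-1` and acting as the cycle `(k k+1 ... n-1)` on the rest. -/
noncomputable def upperCycle (n k : ℕ) (hkn : k < n) : Equiv.Perm (Fin n) :=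
  Equiv.ofBijective
    (fun i => ⟨if (i : ℕ) < k then i else if (i : ℕ) + 1 = n then k else i + 1, by
      have := i.2
      split_ifs <;> omega⟩)
    (Finite.injective_iff_bijective.1 fun a b h => by
      have ha := a.2
      have hb := b.2
      simp only [Fin.mk.injEq] at h
      ext
      split_ifs at h <;> omega)

theorem val_upperCycle {n k : ℕ} (hkn : k < n) (i : Fin n) :
    (upperCycle n k hkn i : ℕ) =
      if (i : ℕ) < k then (i : ℕ) else if (i : ℕ) + 1 = n then k else i + 1 := rfl

/-- The second row, as a matrix indexed by columns and symbols. -/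
noncomputable def cycleRow (n k : ℕ) (hk : 0 < k) (hkn : k < n) (j s : Fin n) : ℕ :=
  (if upperCycle n k hkn j = s then 1 else 0) + if twoCycles n k hk hkn j = s then k - 1 else 0

theorem hasLineSums_cycleRow {n k : ℕ} (hk : 0 < k) (hkn : k < n) :
    HasLineSums k (cycleRow n k hk hkn) := by
  have h := (HasLineSums.perm (upperCycle n k hkn) 1).add
    (HasLineSums.perm (twoCycles n k hk hkn) (k - 1))
  rwa [Nat.add_sub_cancel' hk] at h

theorem starRow_add_cycleRow_le {n k : ℕ} (hk : 2 ≤ k) (hkn : k + 2 ≤ n) (j s : Fin n) :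
    starRow n k j s + cycleRow n k (by omega) (by omega) j s ≤ k := by
  have hj := j.2
  have hs := s.2
  simp only [starRow, cycleRow, Fin.ext_iff, val_twoCycles, val_upperCycle]
  split_ifs <;> omega

/-- If the first two rows of a `k`-latin square are `starRow` and `cycleRow`, then it is
not separable. -/
theorem not_separable_of_rows {n k : ℕ} (hk : 2 ≤ k) (hkn : k < n)
    {L : Fin n → Fin n → Multiset (Fin n)} (hL : IsMultiLatin n k L) {r₀ r₁ : Fin n}
    (hr : r₀ ≠ r₁) (h₀ : ∀ j s, (L r₀ j).count s = starRow n k j s)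
    (h₁ : ∀ j s, (L r₁ j).count s = cycleRow n k (by omega) hkn j s) :
    ¬ Separable n k L := by
  rintro ⟨k₁, k₂, hk₁, hk₂, hsum, L₁, L₂, hL₁, -, hadd⟩
  have hle (i j s) : (L₁ i j).count s ≤ (L i j).count s := by
    rw [hadd, Multiset.count_add]
    exact Nat.le_add_right _ _
  have hzero {i j s} (h : (L i j).count s = 0) : (L₁ i j).count s = 0 :=
    Nat.eq_zero_of_le_zero (h ▸ hle i j s)
  have hcol (a : Fin n) (ha : (a : ℕ) < k) (i : Fin n) (hi : i ≠ r₀ ∧ i ≠ r₁) :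
      (L i a).count a = 0 := by
    have h := hL.2.2 a a
    rw [← Finset.add_sum_erase _ _ (Finset.mem_univ r₀),
      ← Finset.add_sum_erase _ _ (Finset.mem_erase.2 ⟨hr.symm, Finset.mem_univ r₁⟩), h₀, h₁] at h
    have e₀ : starRow n k a a = k - 1 := by
      simp only [starRow]
      split_ifs <;> omega
    have e₁ : cycleRow n k (by omega) hkn a a = 1 := by
      simp only [cycleRow, Fin.ext_iff, val_twoCycles, val_upperCycle]
      split_ifs <;> omega
    have hrest : ∑ i ∈ (Finset.univ.erase r₀).erase r₁, (L i a).count a = 0 := by omega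
    exact (Finset.sum_eq_zero_iff.1 hrest) i (by simp [hi.1, hi.2])
  set z : Fin n := ⟨k, hkn⟩ with hz
  have hcell (a : Fin n) (ha : (a : ℕ) < k) :
      (L₁ r₁ a).count a = (L₁ r₀ z).count a := by
    have hza : z ≠ a := by
      rintro rfl
      simp [hz] at ha
    have e₀ := hL₁.2.1 r₀ a
    rw [Fintype.sum_eq_add z a hza fun j hj => hzero (by
      have h₁ := hj.1
      have h₂ := hj.2
      rw [h₀]
      simp only [starRow, hz, ne_eq, Fin.ext_iff] at *
      split_ifs <;> omega)] at e₀
    have e₁ := hL₁.2.2 a a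
    rw [Fintype.sum_eq_add r₀ r₁ hr fun i hi => hzero (hcol a ha i hi)] at e₁
    omega
  have hstep (a b : Fin n) (hb : (b : ℕ) = a + 1) (hbk : (b : ℕ) < k) :
      (L₁ r₁ b).count b = (L₁ r₁ a).count a := by
    have hab : a ≠ b := by
      rintro rfl
      omega
    have e₀ := hL₁.sum_count r₁ a
    rw [Fintype.sum_eq_add a b hab fun s hs => hzero (by
      have h₁' := hs.1
      have h₂' := hs.2
      rw [h₁]
      simp only [cycleRow, ne_eq, Fin.ext_iff, val_twoCycles, val_upperCycle] at *
      split_ifs <;> omega)] at e₀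
    have e₁ := hL₁.2.1 r₁ b
    rw [Fintype.sum_eq_add a b hab fun j hj => hzero (by
      have h₁' := hj.1
      have h₂' := hj.2
      have := j.2
      rw [h₁]
      simp only [cycleRow, ne_eq, Fin.ext_iff, val_twoCycles, val_upperCycle] at *
      split_ifs <;> omega)] at e₁
    omega
  set x := (L₁ r₁ ⟨0, by omega⟩).count ⟨0, by omega⟩
  have hconst (a : ℕ) (ha : a < k) :
      (L₁ r₁ ⟨a, by omega⟩).count ⟨a, by omega⟩ = x := by
    induction a with
    | zero => rfl
    | succ a ih => rw [hstep ⟨a, by omega⟩ ⟨a + 1, by omega⟩ rfl ha, ih (by omega)]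
  have hk₁x : k₁ = k * x := by
    rw [← hL₁.sum_count r₀ z, ← (hasLineSums_starRow hkn).1 z, Finset.sum_mul]
    refine Finset.sum_congr rfl fun s _ => ?_
    by_cases hs : (s : ℕ) < k
    · rw [← hcell s hs, hconst s hs]
      have : starRow n k z s = 1 := by
        simp only [starRow, hz, Fin.ext_iff]
        split_ifs <;> omega
      rw [this, one_mul]
    · have : starRow n k z s = 0 := by
        simp only [starRow, hz, Fin.ext_iff]
        split_ifs <;> omega
      rw [hzero (by rw [h₀, this]), this, zero_mul]
  rcases Nat.eq_zero_or_pos x with hx | hx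
  · rw [hx] at hk₁x
    omega
  · have := Nat.le_mul_of_pos_right k hx
    omega

/-- For all `k ≥ 3` and `n ≥ k + 2`, there exists a non-separable `k`-latin square of
order `n`. -/
theorem stmt_10 (k n : ℕ) (hk : 3 ≤ k) (hn : k + 2 ≤ n) :
    ∃ L : Fin n → Fin n → Multiset (Fin n),
      IsMultiLatin n k L ∧ ¬ Separable n k L := by
  obtain ⟨m, rfl⟩ : ∃ m, n = m + 2 := ⟨n - 2, by omega⟩
  obtain ⟨T, hT₀, hT₁, hT, hcol⟩ := exists_completion_two_rows
    (hasLineSums_starRow (n := m + 2) (k := k) (by omega))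
    (hasLineSums_cycleRow (by omega) (by omega)) (starRow_add_cycleRow_le (by omega) hn)
  have hL := isMultiLatin_multisetArray hT hcol
  refine ⟨multisetArray T, hL, not_separable_of_rows (r₀ := 0) (r₁ := 1) (by omega) (by omega) hL
    (by simp) (fun j s => ?_) fun j s => ?_⟩
  · rw [count_multisetArray, hT₀]
  · rw [count_multisetArray, hT₁]
end

section
/- For each positive integer n, there exists a finite value g(n) such that for every integer k ≥ g(n), every k-latin square of order n is separable. -/
/-- Cellwise subtraction of a `k`-latin square from a `k'`-latin square containing it. -/
theorem IsMultiLatin.sub {n k k' : ℕ} {L L' : Fin n → Fin n → Multiset (Fin n)}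
    (hL' : IsMultiLatin n k' L') (hL : IsMultiLatin n k L) (h : ∀ i j, L i j ≤ L' i j) :
    IsMultiLatin n (k' - k) (fun i j => L' i j - L i j) := by
  obtain ⟨hc, hr, hs⟩ := hL
  obtain ⟨hc', hr', hs'⟩ := hL'
  refine ⟨fun i j => ?_, fun i s => ?_, fun j s => ?_⟩
  · rw [Multiset.card_sub (h i j), hc, hc']
  · simp only [Multiset.count_sub]
    rw [Finset.sum_tsub_distrib _ fun j _ => Multiset.le_iff_count.1 (h i j) s, hr, hr']
  · simp only [Multiset.count_sub]
    rw [Finset.sum_tsub_distrib _ fun i _ => Multiset.le_iff_count.1 (h i j) s, hs, hs']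

/-- A `k'`-latin square containing a `k`-latin square with `0 < k < k'` is separable. -/
theorem IsMultiLatin.separable_of_le {n k k' : ℕ} {L L' : Fin n → Fin n → Multiset (Fin n)}
    (hL' : IsMultiLatin n k' L') (hL : IsMultiLatin n k L) (h : ∀ i j, L i j ≤ L' i j)
    (hk : 0 < k) (hkk' : k < k') : Separable n k' L' :=
  ⟨k, k' - k, hk, Nat.sub_pos_of_lt hkk', Nat.add_sub_cancel' hkk'.le, L, _, hL, hL'.sub hL h,
    fun i j => (add_tsub_cancel_of_le (h i j)).symm⟩

/-- For each positive integer `n` there is a finite `g n` such that for every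
`k ≥ g n`, every `k`-latin square of order `n` is separable. -/
theorem stmt_12 (n : ℕ) (hn : 0 < n) :
    ∃ g : ℕ, ∀ k : ℕ, g ≤ k →
      ∀ L : Fin n → Fin n → Multiset (Fin n), IsMultiLatin n k L → Separable n k L := by
  by_contra! H
  choose k hk L hL hsep using fun m : ℕ => H (m + 1)
  obtain ⟨φ, hφ⟩ := wellQuasiOrdered_iff_exists_monotone_subseq.1
    (wellQuasiOrdered_le (α := Fin n → Fin n → Fin n → ℕ)) fun m i j s => (L m i j).count s
  have hkφ := hk (φ (k (φ 0)))
  have hφk := φ.strictMono.le_apply (x := k (φ 0))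
  have hk0 := hk (φ 0)
  have hlt : k (φ 0) < k (φ (k (φ 0))) := by omega
  exact hsep _ ((hL _).separable_of_le (hL (φ 0))
    (fun i j => Multiset.le_iff_count.2 (hφ 0 _ (Nat.zero_le _) i j)) (by omega) hlt)
end

section
/- If L is a non-erodable k-latin square of order n with k ≥ 2, then the join L ⊕ L is a 2k-latin square of order n that is separable but non-erodable. -/
theorem IsMultiLatin.join {n k₁ k₂ : ℕ} {L₁ L₂ : Fin n → Fin n → Multiset (Fin n)}
    (h₁ : IsMultiLatin n k₁ L₁) (h₂ : IsMultiLatin n k₂ L₂) :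
    IsMultiLatin n (k₁ + k₂) (fun i j => L₁ i j + L₂ i j) := by
  refine ⟨fun i j => ?_, fun i s => ?_, fun j s => ?_⟩
  · simp [h₁.1, h₂.1]
  · simp [Finset.sum_add_distrib, h₁.2.1, h₂.2.1]
  · simp [Finset.sum_add_distrib, h₁.2.2, h₂.2.2]

theorem IsMultiLatin.sub_s14 {n k₁ k₂ : ℕ} {L₁ L₂ : Fin n → Fin n → Multiset (Fin n)}
    (h₁ : IsMultiLatin n k₁ L₁) (h₂ : IsMultiLatin n k₂ L₂) (hle : ∀ i j, L₂ i j ≤ L₁ i j) :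
    IsMultiLatin n (k₁ - k₂) (fun i j => L₁ i j - L₂ i j) := by
  refine ⟨fun i j => ?_, fun i s => ?_, fun j s => ?_⟩
  · simp [Multiset.card_sub (hle i j), h₁.1, h₂.1]
  · simp only [Multiset.count_sub]
    rw [Finset.sum_tsub_distrib _ fun j _ => Multiset.count_le_of_le s (hle i j), h₁.2.1, h₂.2.1]
  · simp only [Multiset.count_sub]
    rw [Finset.sum_tsub_distrib _ fun i _ => Multiset.count_le_of_le s (hle i j), h₁.2.2, h₂.2.2]

/-- A `k`-latin square is erodable as soon as it contains a latin square cellwise. -/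
theorem Erodable.of_le {n k : ℕ} {L M : Fin n → Fin n → Multiset (Fin n)}
    (hL : IsMultiLatin n k L) (hM : IsMultiLatin n 1 M) (hle : ∀ i j, M i j ≤ L i j) :
    Erodable n k L :=
  ⟨fun i j => L i j - M i j, M, hL.sub_s14 hM hle, hM, fun i j => (tsub_add_cancel_of_le (hle i j)).symm⟩

theorem Erodable.of_join_self {n k m : ℕ} {L : Fin n → Fin n → Multiset (Fin n)}
    (hL : IsMultiLatin n k L) (h : Erodable n m (fun i j => L i j + L i j)) :
    Erodable n k L := by
  obtain ⟨L₁, L₂, -, h₂, hsum⟩ := h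
  refine .of_le hL h₂ fun i j => ?_
  obtain ⟨s, hs⟩ := Multiset.card_eq_one.mp (h₂.1 i j)
  have hmem : s ∈ L i j + L i j := by simp [hsum i j, hs]
  rw [hs, Multiset.singleton_le]
  simpa using hmem

/-- If `L` is a non-erodable `k`-latin square of order `n` with `k ≥ 2`, then the join
`L ⊕ L` is a `2k`-latin square of order `n` which is separable but non-erodable. -/
theorem stmt_14 (n k : ℕ) (hk : 2 ≤ k) (L : Fin n → Fin n → Multiset (Fin n))
    (hL : IsMultiLatin n k L) (hNE : ¬ Erodable n k L) :
    IsMultiLatin n (2 * k) (fun i j => L i j + L i j) ∧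
    Separable n (2 * k) (fun i j => L i j + L i j) ∧
    ¬ Erodable n (2 * k) (fun i j => L i j + L i j) := by
  refine ⟨two_mul k ▸ hL.join hL, ?_, fun h => hNE (.of_join_self hL h)⟩
  exact ⟨k, k, by omega, by omega, (two_mul k).symm, L, L, hL, hL, fun _ _ => rfl⟩
end
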